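/- arXiv:1807.07057 — 4 statements merged into one kernel-verified Lean document; each statement's English description precedes it below -/
import Mathlib

section
/- Let m ≥ 20 be an integer and let G be a 3-graph satisfying e(G) > (m/3)·|∂(G)| and δ₂(G) > m/3. Let w be the default weight function on E(G) and ∂(G). Then there exist edges e = abc and f = adc in G (sharing exactly the pair {a,c}) satisfying: (a) w(e) < 3/m and w({a,c}) < 1/m; (b) min{d′_{e,f}(a,b), d′_{e,f}(c,b)} ≥ ⌊m/3⌋; (c) max{d′_{e,f}(a,b), d′_{e,f}(c,b)} ≥ ⌊2m/3⌋; and (d) either 3·(w(f) − 3/m) < 3/m − w(e) or max{d′_{e,f}(a,d), d′_{e,f}(c,d)} ≥ m − 1. -/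
open Finset

variable {V : Type*}

/-- The number of edges of `G` containing the vertex set `D`. -/
def degree [DecidableEq V] (G : Finset (Finset V)) (D : Finset V) : ℕ :=
  (G.filter fun e => D ⊆ e).card

/-- The shadow of an `r`-graph `G`: all `(r-1)`-element sets contained in some edge. -/
def hshadow [DecidableEq V] (G : Finset (Finset V)) (r : ℕ) : Finset (Finset V) :=
  G.biUnion fun e => e.powersetCard (r - 1)

/-- The default weight of an edge `e` of an `r`-graph `G`. -/
noncomputable def weight [DecidableEq V] (G : Finset (Finset V)) (r : ℕ) (e : Finset V) : ℝ :=
  ∑ D ∈ e.powersetCard (r - 1), (1 : ℝ) / (degree G D : ℝ)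

/-- `e 0, e 1, …, e (t-1)` is a proper ordering of the edges of the tight `r`-tree `T`. -/
def IsTightTreeOrdering [DecidableEq V] (r : ℕ) (T : Finset (Finset V))
    (e : ℕ → Finset V) (t : ℕ) : Prop :=
  T = (Finset.range t).image e ∧
  (∀ i < t, (e i).card = r) ∧
  ∀ i, 0 < i → i < t →
    ∃ v ∈ e i, (∀ j < i, v ∉ e j) ∧ ∃ j < i, (e i).erase v ⊆ e j

/-- `T` is a tight `r`-tree. -/
def IsTightTree [DecidableEq V] (r : ℕ) (T : Finset (Finset V)) : Prop :=
  ∃ e t, IsTightTreeOrdering r T e t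

/-- A leaf of `T` is a vertex of degree one. -/
def IsLeaf [DecidableEq V] (T : Finset (Finset V)) (v : V) : Prop :=
  (T.filter fun g => v ∈ g).card = 1

/-- `T'` is a trunk of the tight `r`-tree `T`: in some proper ordering of the edges of `T`
the edges of `T'` come first, and all vertices of `T` outside `T'` are leaves of `T`. -/
def IsTrunk [DecidableEq V] (r : ℕ) (T T' : Finset (Finset V)) : Prop :=
  ∃ e t t', t' ≤ t ∧ IsTightTreeOrdering r T e t ∧
    T' = (Finset.range t').image e ∧
    ∀ v ∈ T.biUnion id, v ∉ T'.biUnion id → IsLeaf T v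

/-- `G` contains a copy of `T`: an injection of the vertex set of `T` into the vertices of `G`
mapping edges of `T` to edges of `G`. -/
def ContainsCopy {W : Type*} [DecidableEq V] [DecidableEq W]
    (G : Finset (Finset W)) (T : Finset (Finset V)) : Prop :=
  ∃ f : V → W, Set.InjOn f ↑(T.biUnion id) ∧ ∀ g ∈ T, g.image f ∈ G

/-- Given a set `S = {a,b,c,d}`, `dprime G S x y` is the number of vertices `z ∉ S`
with `{x,y,z}` an edge of `G`. -/
def dprime [Fintype V] [DecidableEq V] (G : Finset (Finset V)) (S : Finset V) (x y : V) : ℕ :=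
  (Finset.univ.filter fun z => z ∉ S ∧ ({x, y, z} : Finset V) ∈ G).card

/-- The minimum codegree over the pairs of vertices contained in the edge `e`. -/
noncomputable def dmin [DecidableEq V] (G : Finset (Finset V)) (e : Finset V) : ℕ :=
  sInf {k | ∃ D ⊆ e, D.card = 2 ∧ degree G D = k}

/-- The neighbourhood `N_G(B)`: all vertices `z ∉ B` with `B ∪ {z}` an edge. -/
def nbr [Fintype V] [DecidableEq V] (G : Finset (Finset V)) (B : Finset V) : Finset V :=
  Finset.univ.filter fun z => z ∉ B ∧ insert z B ∈ G

section Link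

variable [Fintype V] [DecidableEq V] {G : Finset (Finset V)}

/-- The vertices completing the pair `x, y` to an edge of `G`. -/
def link (G : Finset (Finset V)) (x y : V) : Finset V :=
  Finset.univ.filter fun z => ({x, y, z} : Finset V) ∈ G

lemma mem_link {x y z : V} : z ∈ link G x y ↔ ({x, y, z} : Finset V) ∈ G := by
  simp [link]

lemma ne_of_mem_link (hG : ∀ g ∈ G, g.card = 3) {x y z : V} (hz : z ∈ link G x y) :
    z ≠ x ∧ z ≠ y := by
  have h3 := hG _ (mem_link.1 hz)
  constructor <;> rintro rfl
  · rw [Finset.insert_eq_of_mem (by simp)] at h3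
    have := Finset.card_le_two (a := y) (b := z)
    omega
  · rw [Finset.pair_eq_singleton] at h3
    have := Finset.card_le_two (a := x) (b := z)
    omega

lemma card_link (hG : ∀ g ∈ G, g.card = 3) {x y : V} (hxy : x ≠ y) :
    (link G x y).card = degree G {x, y} := by
  unfold degree
  refine Finset.card_bij (fun z _ => {x, y, z}) ?_ ?_ ?_
  · intro z hz
    rw [Finset.mem_filter]
    refine ⟨mem_link.1 hz, ?_⟩
    intro t
    simp only [Finset.mem_insert, Finset.mem_singleton]
    tauto
  · intro z hz z' hz' h
    have hne := ne_of_mem_link hG hz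
    have : z ∈ ({x, y, z'} : Finset V) := h ▸ (by simp)
    simp only [Finset.mem_insert, Finset.mem_singleton] at this
    tauto
  · intro e he
    rw [Finset.mem_filter] at he
    have h1 : (e \ {x, y}).card = 1 := by
      rw [Finset.card_sdiff_of_subset he.2, hG e he.1, Finset.card_pair hxy]
    obtain ⟨z, hz⟩ := Finset.card_eq_one.1 h1
    have hz' : ({x, y, z} : Finset V) = e := by
      rw [← Finset.union_sdiff_of_subset he.2, hz]
      ext t
      simp
    exact ⟨z, mem_link.2 (hz' ▸ he.1), hz'⟩

lemma link_sdiff_card_le_dprime (hG : ∀ g ∈ G, g.card = 3) {S T : Finset V} {x y : V}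
    (hS : S ⊆ insert x (insert y T)) :
    (link G x y \ T).card ≤ dprime G S x y := by
  refine Finset.card_le_card fun z hz => ?_
  rw [Finset.mem_sdiff] at hz
  have hne := ne_of_mem_link hG hz.1
  simp only [Finset.mem_filter, Finset.mem_univ, true_and]
  refine ⟨fun h => ?_, mem_link.1 hz.1⟩
  have := hS h
  simp only [Finset.mem_insert] at this
  tauto

lemma degree_le_dprime_add_two (hG : ∀ g ∈ G, g.card = 3) {S : Finset V} {x y u v : V}
    (hxy : x ≠ y) (hS : S ⊆ {x, y, u, v}) :
    degree G {x, y} ≤ dprime G S x y + 2 := by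
  have h1 := link_sdiff_card_le_dprime (G := G) hG (T := {u, v}) hS
  have h2 := Finset.le_card_sdiff {u, v} (link G x y)
  have h3 := Finset.card_le_two (a := u) (b := v)
  rw [card_link hG hxy] at h2
  omega

lemma degree_le_dprime_add_one (hG : ∀ g ∈ G, g.card = 3) {S : Finset V} {x y u v : V}
    (hxy : x ≠ y) (hS : S ⊆ {x, y, u, v}) (hv : v ∉ (link G x y).erase u) :
    degree G {x, y} ≤ dprime G S x y + 1 := by
  have h1 := link_sdiff_card_le_dprime (G := G) hG (T := {u, v}) hS
  have h2 := Finset.le_card_sdiff {u} (link G x y)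
  have h3 : link G x y \ {u, v} = link G x y \ {u} := by
    ext z
    simp only [Finset.mem_sdiff, Finset.mem_insert, Finset.mem_singleton, not_or]
    refine ⟨fun h => ⟨h.1, h.2.1⟩, fun h => ⟨h.1, h.2, ?_⟩⟩
    rintro rfl
    exact hv (Finset.mem_erase.2 ⟨h.2, h.1⟩)
  rw [card_link hG hxy, Finset.card_singleton, ← h3] at h2
  omega

end Link

lemma weight_triple [DecidableEq V] {G : Finset (Finset V)}
    {a b c : V} (hab : a ≠ b) (hac : a ≠ c) (hbc : b ≠ c) :
    weight G 3 {a, b, c} =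
      1 / (degree G {a, b} : ℝ) + 1 / (degree G {c, b} : ℝ) + 1 / (degree G {a, c} : ℝ) := by
  have h1 : ({a, b} : Finset V) ≠ {c, b} := fun h => by
    have := Finset.ext_iff.1 h a
    simp only [Finset.mem_insert, Finset.mem_singleton] at this
    tauto
  have h2 : ({a, b} : Finset V) ≠ {a, c} := fun h => by
    have := Finset.ext_iff.1 h b
    simp only [Finset.mem_insert, Finset.mem_singleton] at this
    grind
  have h3 : ({c, b} : Finset V) ≠ {a, c} := fun h => by
    have := Finset.ext_iff.1 h b
    simp only [Finset.mem_insert, Finset.mem_singleton] at this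
    grind
  have h : ({{a, b}, {c, b}, {a, c}} : Finset (Finset V)) =
      ({a, b, c} : Finset V).powersetCard (3 - 1) := by
    apply Finset.eq_of_subset_of_card_le
    · intro D hD
      simp only [Finset.mem_insert, Finset.mem_singleton] at hD
      rw [Finset.mem_powersetCard]
      rcases hD with rfl | rfl | rfl
      · exact ⟨by grind, Finset.card_pair hab⟩
      · exact ⟨by grind, Finset.card_pair hbc.symm⟩
      · exact ⟨by grind, Finset.card_pair hac⟩
    · rw [Finset.card_powersetCard, Finset.card_eq_three.2 ⟨a, b, c, hab, hac, hbc, rfl⟩,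
        Finset.card_insert_of_notMem (by simp [h1, h2]), Finset.card_pair h3]
      decide
  unfold weight
  rw [← h, Finset.sum_insert (by simp [h1, h2]), Finset.sum_pair h3, add_assoc]

lemma sum_weight [DecidableEq V] (G : Finset (Finset V)) (r : ℕ) :
    ∑ e ∈ G, weight G r e = (hshadow G r).card := by
  have h : ∀ e ∈ G, weight G r e =
      ∑ D ∈ hshadow G r, if D ∈ e.powersetCard (r - 1) then 1 / (degree G D : ℝ) else 0 := by
    intro e he
    rw [← Finset.sum_filter, weight]
    refine Finset.sum_congr ?_ fun _ _ => rfl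
    ext D
    simp only [hshadow, Finset.mem_filter, Finset.mem_biUnion]
    exact ⟨fun hD => ⟨⟨e, he, hD⟩, hD⟩, fun hD => hD.2⟩
  rw [Finset.sum_congr rfl h, Finset.sum_comm, Finset.card_eq_sum_ones, Nat.cast_sum]
  refine Finset.sum_congr rfl fun D hD => ?_
  obtain ⟨e, he, hDe⟩ := Finset.mem_biUnion.1 hD
  have hcard := (Finset.mem_powersetCard.1 hDe).2
  have hdeg : (G.filter fun e => D ∈ e.powersetCard (r - 1)) = G.filter fun e => D ⊆ e := by
    refine Finset.filter_congr fun e _ => ?_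
    simp [Finset.mem_powersetCard, hcard]
  have hpos : 0 < degree G D :=
    Finset.card_pos.2 ⟨e, Finset.mem_filter.2 ⟨he, (Finset.mem_powersetCard.1 hDe).1⟩⟩
  rw [← Finset.sum_filter, hdeg, Finset.sum_const, nsmul_eq_mul]
  change (degree G D : ℝ) * _ = _
  have : (degree G D : ℝ) ≠ 0 := by positivity
  field_simp
  simp

lemma four_mul_le_of_reciprocals_lt_of_le {m x y D : ℕ} (hm : 20 ≤ m) (hx : m / 3 < x)
    (hxy : x ≤ y) (hyD : y ≤ D)
    (h : 1 / (x : ℝ) + 1 / (y : ℝ) + 1 / (D : ℝ) < 3 / (m : ℝ)) :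
    (m / 3 + 2 ≤ x ∧ m / 3 + 2 ≤ y ∧ 2 * m / 3 + 2 ≤ y) ∨
    (4 * x ≤ D ∧ m / 3 + 2 ≤ y ∧ 2 * m / 3 + 2 ≤ y) ∨
    (4 * y ≤ D ∧ m / 3 + 2 ≤ x ∧ 2 * m / 3 + 1 ≤ y) := by
  have hx0 : 0 < (x : ℝ) := by exact_mod_cast (by omega : 0 < x)
  have hy0 : 0 < (y : ℝ) := by exact_mod_cast (by omega : 0 < y)
  have hD0 : 0 < (D : ℝ) := by exact_mod_cast (by omega : 0 < D)
  have hm0 : 0 < (m : ℝ) := by exact_mod_cast (by omega : 0 < m)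
  have hxy' : (x : ℝ) ≤ y := by exact_mod_cast hxy
  have hyD' : (y : ℝ) ≤ D := by exact_mod_cast hyD
  have hrec : 1 / (y : ℝ) ≤ 1 / x := one_div_le_one_div_of_le hx0 hxy'
  have hrecD : 1 / (D : ℝ) ≤ 1 / y := one_div_le_one_div_of_le hy0 hyD'
  have hDpos : 0 < 1 / (D : ℝ) := by positivity
  by_cases hsmall : x ≤ m / 3 + 1
  · have hx7 : 7 ≤ x := by omega
    have hx7' : (7 : ℝ) ≤ x := by exact_mod_cast hx7
    have h3 : 3 * (x : ℝ) - 3 ≤ m := by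
      have : 3 * x ≤ m + 3 := by omega
      have : 3 * (x : ℝ) ≤ m + 3 := by exact_mod_cast this
      linarith
    have h4 : 3 / (m : ℝ) ≤ 1 / (x - 1) := by
      rw [div_le_div_iff₀ hm0 (by linarith)]; linarith
    have h5 : 1 / ((x : ℝ) - 1) - 1 / x = 1 / ((x - 1) * x) := by
      have : (x : ℝ) - 1 ≠ 0 := by linarith
      field_simp
      ring
    have hpos : 0 < ((x : ℝ) - 1) * x := mul_pos (by linarith) hx0
    have h6 : 1 / (y : ℝ) < 1 / ((x - 1) * x) := by linarith
    have h7 : 2 / (D : ℝ) < 1 / ((x - 1) * x) := by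
      have : 2 / (D : ℝ) = 1 / D + 1 / D := by ring
      linarith
    rw [div_lt_div_iff₀ hy0 hpos] at h6
    rw [div_lt_div_iff₀ hD0 hpos] at h7
    have h8 : 6 * (x : ℝ) < y := by nlinarith
    have h9 : 4 * (x : ℝ) ≤ D := by nlinarith
    have h8' : 6 * x < y := by exact_mod_cast h8
    have h9' : 4 * x ≤ D := by exact_mod_cast h9
    right; left
    omega
  · have h1 : 2 / (y : ℝ) < 3 / m := by
      have : 2 / (y : ℝ) = 1 / y + 1 / y := by ring
      linarith
    have h2 : 2 * m < 3 * y := by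
      rw [div_lt_div_iff₀ hy0 hm0] at h1
      exact_mod_cast h1
    by_cases hlarge : 2 * m / 3 + 2 ≤ y
    · left; omega
    · have hy14 : (14 : ℝ) ≤ y := by exact_mod_cast (by omega : 14 ≤ y)
      have h3 : 3 * (y : ℝ) - 3 ≤ 2 * m := by
        have : 3 * y ≤ 2 * m + 3 := by omega
        have : 3 * (y : ℝ) ≤ 2 * m + 3 := by exact_mod_cast this
        linarith
      have h4 : 3 / (m : ℝ) ≤ 2 / (y - 1) := by
        rw [div_le_div_iff₀ hm0 (by linarith)]; linarith
      have h5 : 2 / ((y : ℝ) - 1) - 2 / y = 2 / ((y - 1) * y) := by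
        have : (y : ℝ) - 1 ≠ 0 := by linarith
        field_simp
        ring
      have hpos : 0 < ((y : ℝ) - 1) * y := mul_pos (by linarith) hy0
      have h6 : 1 / (D : ℝ) < 2 / ((y - 1) * y) := by
        have : 2 / (y : ℝ) = 1 / y + 1 / y := by ring
        linarith
      rw [div_lt_div_iff₀ hD0 hpos] at h6
      have h7 : 4 * (y : ℝ) ≤ D := by nlinarith
      have h7' : 4 * y ≤ D := by exact_mod_cast h7
      right; right
      omega

section Discharging

variable [Fintype V] [DecidableEq V] {G : Finset (Finset V)}

/-- For a light edge `abc` whose heaviest-degree pair is `ac`, all but few vertices `d`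
leave enough extensions of `ab` and `cb`. -/
lemma exists_small_exceptional_set {m : ℕ} (hm : 20 ≤ m) (hG : ∀ g ∈ G, g.card = 3)
    {a b c : V} (hab : a ≠ b) (hcb : c ≠ b)
    (hx : m / 3 < degree G {a, b}) (hy : m / 3 < degree G {c, b})
    (hxD : degree G {a, b} ≤ degree G {a, c}) (hyD : degree G {c, b} ≤ degree G {a, c})
    (habc : ({a, b, c} : Finset V) ∈ G)
    (hw : 1 / (degree G {a, b} : ℝ) + 1 / (degree G {c, b} : ℝ) + 1 / (degree G {a, c} : ℝ)
      < 3 / (m : ℝ)) :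
    ∃ S : Finset V, 4 * (S.card + 1) ≤ degree G {a, c} ∧ ∀ d ∉ S,
      m / 3 ≤ dprime G {a, b, c, d} a b ∧ m / 3 ≤ dprime G {a, b, c, d} c b ∧
      (2 * m / 3 ≤ dprime G {a, b, c, d} a b ∨ 2 * m / 3 ≤ dprime G {a, b, c, d} c b) := by
  have hsub (d : V) : ({a, b, c, d} : Finset V) ⊆ {c, b, a, d} := by simp [Finset.insert_subset_iff]
  have hA2 (d : V) := degree_le_dprime_add_two hG hab (Finset.Subset.refl {a, b, c, d})
  have hC2 (d : V) := degree_le_dprime_add_two hG hcb (hsub d)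
  have hA1 (d : V) := degree_le_dprime_add_one hG (v := d) hab (Finset.Subset.refl {a, b, c, d})
  have hC1 (d : V) := degree_le_dprime_add_one hG (v := d) hcb (hsub d)
  have hcA : ((link G a b).erase c).card + 1 = degree G {a, b} := by
    rw [Finset.card_erase_add_one (mem_link.2 habc), card_link hG hab]
  have hcC : ((link G c b).erase a).card + 1 = degree G {c, b} := by
    rw [Finset.card_erase_add_one, card_link hG hcb]
    rw [mem_link]
    rwa [Finset.insert_comm c, Finset.pair_comm c, Finset.insert_comm b]
  have key : (m / 3 + 2 ≤ degree G {a, b} ∧ m / 3 + 2 ≤ degree G {c, b} ∧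
        (2 * m / 3 + 2 ≤ degree G {a, b} ∨ 2 * m / 3 + 2 ≤ degree G {c, b})) ∨
      (4 * degree G {a, b} ≤ degree G {a, c} ∧ m / 3 + 2 ≤ degree G {c, b} ∧
        (2 * m / 3 + 1 ≤ degree G {a, b} ∨ 2 * m / 3 + 2 ≤ degree G {c, b})) ∨
      (4 * degree G {c, b} ≤ degree G {a, c} ∧ m / 3 + 2 ≤ degree G {a, b} ∧
        (2 * m / 3 + 2 ≤ degree G {a, b} ∨ 2 * m / 3 + 1 ≤ degree G {c, b})) := by
    rcases le_total (degree G {a, b}) (degree G {c, b}) with h | h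
    · rcases four_mul_le_of_reciprocals_lt_of_le hm hx h hyD hw with h' | h' | h'
      · exact Or.inl ⟨h'.1, h'.2.1, Or.inr h'.2.2⟩
      · exact Or.inr (Or.inl ⟨h'.1, h'.2.1, Or.inr h'.2.2⟩)
      · exact Or.inr (Or.inr ⟨h'.1, h'.2.1, Or.inr h'.2.2⟩)
    · rcases four_mul_le_of_reciprocals_lt_of_le hm hy h hxD
        (by rw [add_comm (1 / (degree G {c, b} : ℝ))]; exact hw) with h' | h' | h'
      · exact Or.inl ⟨h'.2.1, h'.1, Or.inl h'.2.2⟩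
      · exact Or.inr (Or.inr ⟨h'.1, h'.2.1, Or.inl h'.2.2⟩)
      · exact Or.inr (Or.inl ⟨h'.1, h'.2.1, Or.inl h'.2.2⟩)
  rcases key with h | h | h
  · refine ⟨∅, by rw [Finset.card_empty]; omega, fun d _ => ?_⟩
    have := hA2 d
    have := hC2 d
    omega
  · refine ⟨(link G a b).erase c, by omega, fun d hd => ?_⟩
    have := hA1 d hd
    have := hC2 d
    omega
  · refine ⟨(link G c b).erase a, by omega, fun d hd => ?_⟩
    have := hA2 d
    have := hC1 d hd
    omega

end Discharging

/-- Lemma 3.1 (the first discharging lemma). -/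
theorem stmt7 {V : Type*} [Fintype V] [DecidableEq V] (m : ℕ) (hm : 20 ≤ m)
    (G : Finset (Finset V)) (hG : ∀ g ∈ G, g.card = 3)
    (hsize : (m : ℝ) / 3 * ((hshadow G 3).card : ℝ) < (G.card : ℝ))
    (hdelta : ∀ D ∈ hshadow G 3, (m : ℝ) / 3 < (degree G D : ℝ)) :
    ∃ a b c d : V, a ≠ b ∧ a ≠ c ∧ a ≠ d ∧ b ≠ c ∧ b ≠ d ∧ c ≠ d ∧
      ({a, b, c} : Finset V) ∈ G ∧ ({a, d, c} : Finset V) ∈ G ∧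
      -- (a)
      weight G 3 {a, b, c} < 3 / (m : ℝ) ∧
      (1 : ℝ) / (degree G {a, c} : ℝ) < 1 / (m : ℝ) ∧
      -- (b)
      m / 3 ≤ dprime G {a, b, c, d} a b ∧ m / 3 ≤ dprime G {a, b, c, d} c b ∧
      -- (c)
      (2 * m / 3 ≤ dprime G {a, b, c, d} a b ∨ 2 * m / 3 ≤ dprime G {a, b, c, d} c b) ∧
      -- (d)
      (3 * (weight G 3 {a, d, c} - 3 / (m : ℝ)) < 3 / (m : ℝ) - weight G 3 {a, b, c} ∨
        m - 1 ≤ dprime G {a, b, c, d} a d ∨ m - 1 ≤ dprime G {a, b, c, d} c d) := by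
  have hm0 : 0 < (m : ℝ) := by exact_mod_cast (by omega : 0 < m)
  have hdeltaN : ∀ {D e : Finset V}, e ∈ G → D ⊆ e → D.card = 2 → m / 3 < degree G D := by
    intro D e he hDe hD
    have := hdelta D (Finset.mem_biUnion.2 ⟨e, he, Finset.mem_powersetCard.2 ⟨hDe, hD⟩⟩)
    rw [div_lt_iff₀ (by norm_num)] at this
    have : m < degree G D * 3 := by exact_mod_cast this
    omega
  have hmax : ∀ e : Finset V, ∃ P : Finset V, e ∈ G → P ⊆ e ∧ P.card = 2 ∧
      ∀ D ⊆ e, D.card = 2 → degree G D ≤ degree G P := by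
    intro e
    by_cases he : e ∈ G
    · obtain ⟨P, hP, hPmax⟩ := (e.powersetCard 2).exists_max_image (degree G)
        (Finset.powersetCard_nonempty.2 (by rw [hG e he]; norm_num))
      rw [Finset.mem_powersetCard] at hP
      exact ⟨P, fun _ => ⟨hP.1, hP.2, fun D h1 h2 =>
        hPmax D (Finset.mem_powersetCard.2 ⟨h1, h2⟩)⟩⟩
    · exact ⟨∅, fun h => absurd h he⟩
  choose φ hφ using hmax
  have hneg : ∑ e ∈ G, (weight G 3 e - 3 / (m : ℝ)) < 0 := by
    rw [Finset.sum_sub_distrib, sum_weight, Finset.sum_const, nsmul_eq_mul]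
    have : ((hshadow G 3).card : ℝ) < G.card * (3 / (m : ℝ)) := by
      rw [← mul_div_assoc, lt_div_iff₀ hm0]
      linarith
    linarith
  have hmaps : ∀ e ∈ G, φ e ∈ hshadow G 3 := fun e he =>
    Finset.mem_biUnion.2 ⟨e, he, Finset.mem_powersetCard.2 ⟨(hφ e he).1, (hφ e he).2.1⟩⟩
  rw [← Finset.sum_fiberwise_of_maps_to hmaps] at hneg
  obtain ⟨P, -, hPneg⟩ := Finset.exists_lt_of_sum_lt
    (hneg.trans_le (Finset.sum_const_zero (s := hshadow G 3)).ge)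
  set X := G.filter fun e => φ e = P with hX
  have hXne : X.Nonempty := by
    rw [Finset.nonempty_iff_ne_empty]
    intro h
    rw [h] at hPneg
    simp at hPneg
  obtain ⟨e, heX, hemin⟩ := X.exists_min_image (weight G 3) hXne
  have hew : weight G 3 e < 3 / (m : ℝ) := by
    by_contra! h
    exact hPneg.not_ge (Finset.sum_nonneg fun f hf => sub_nonneg.2 (h.trans (hemin f hf)))
  have heG : e ∈ G := (Finset.mem_filter.1 heX).1
  obtain ⟨hPe, hPcard, hPmax⟩ := hφ e heG
  rw [(Finset.mem_filter.1 heX).2] at hPe hPcard hPmax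
  obtain ⟨a, c, hac, rfl⟩ := Finset.card_eq_two.1 hPcard
  obtain ⟨b, hb⟩ : ∃ b, e \ {a, c} = {b} := by
    rw [← Finset.card_eq_one, Finset.card_sdiff_of_subset hPe, hG e heG, hPcard]
  have hbn : b ∉ ({a, c} : Finset V) := by
    have : b ∈ e \ {a, c} := hb ▸ Finset.mem_singleton_self b
    exact (Finset.mem_sdiff.1 this).2
  simp only [Finset.mem_insert, Finset.mem_singleton, not_or] at hbn
  obtain rfl : e = {a, b, c} := by
    rw [← Finset.union_sdiff_of_subset hPe, hb]
    ext t
    simp only [Finset.mem_union, Finset.mem_insert, Finset.mem_singleton]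
    rw [or_assoc, or_comm (a := t = c)]
  have hab : a ≠ b := Ne.symm hbn.1
  have hcb : c ≠ b := Ne.symm hbn.2
  have hxD := hPmax {a, b} (by simp [Finset.insert_subset_iff]) (Finset.card_pair hab)
  have hyD := hPmax {c, b} (by simp [Finset.insert_subset_iff]) (Finset.card_pair hcb)
  have hx := hdeltaN (D := {a, b}) heG (by simp [Finset.insert_subset_iff]) (Finset.card_pair hab)
  have hy := hdeltaN (D := {c, b}) heG (by simp [Finset.insert_subset_iff]) (Finset.card_pair hcb)
  have hw3 := hew
  rw [weight_triple hab hac hcb.symm] at hw3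
  obtain ⟨S, hScard, hS⟩ := exists_small_exceptional_set hm hG hab hcb hx hy hxD hyD heG hw3
  have hDm : (1 : ℝ) / (degree G {a, c} : ℝ) < 1 / (m : ℝ) := by
    have h1 : (1 : ℝ) / (degree G {a, c}) ≤ 1 / degree G {a, b} :=
      one_div_le_one_div_of_le (by exact_mod_cast (by omega : 0 < degree G {a, b}))
        (by exact_mod_cast hxD)
    have h2 : (1 : ℝ) / (degree G {a, c}) ≤ 1 / degree G {c, b} :=
      one_div_le_one_div_of_le (by exact_mod_cast (by omega : 0 < degree G {c, b}))
        (by exact_mod_cast hyD)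
    have h3 : 3 / (m : ℝ) = 3 * (1 / m) := by ring
    linarith
  have hmD : m < degree G {a, c} := by
    rw [one_div_lt_one_div (by exact_mod_cast (by omega : 0 < degree G {a, c})) hm0] at hDm
    exact_mod_cast hDm
  by_contra hno
  set δ := 3 / (m : ℝ) - weight G 3 {a, b, c} with hδ
  have hδ0 : 0 < δ := sub_pos.2 hew
  set N := link G a c \ insert b S with hN
  have hheavy : ∀ d ∈ N, ({a, c, d} : Finset V) ∈ X ∧
      δ / 3 ≤ weight G 3 {a, c, d} - 3 / (m : ℝ) := by
    intro d hd
    rw [hN, Finset.mem_sdiff, Finset.mem_insert, not_or] at hd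
    obtain ⟨hdl, hdb, hdS⟩ := hd
    obtain ⟨hda, hdc⟩ := ne_of_mem_link hG hdl
    have hacd : ({a, d, c} : Finset V) = {a, c, d} := by rw [Finset.pair_comm d c]
    have hf := mem_link.1 hdl
    have hnd : ¬ (3 * (weight G 3 {a, d, c} - 3 / (m : ℝ)) < δ ∨
        m - 1 ≤ dprime G {a, b, c, d} a d ∨ m - 1 ≤ dprime G {a, b, c, d} c d) := fun h =>
      hno ⟨a, b, c, d, hab, hac, hda.symm, hcb.symm, Ne.symm hdb, hdc.symm, heG, hacd ▸ hf,
        hew, hDm, (hS d hdS).1, (hS d hdS).2.1, (hS d hdS).2.2, h⟩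
    push Not at hnd
    obtain ⟨hn1, hn2, hn3⟩ := hnd
    rw [hacd] at hn1
    refine ⟨?_, by linarith⟩
    have had := degree_le_dprime_add_two hG hda.symm
      (show ({a, b, c, d} : Finset V) ⊆ {a, d, b, c} by simp [Finset.insert_subset_iff])
    have hcd := degree_le_dprime_add_two hG hdc.symm
      (show ({a, b, c, d} : Finset V) ⊆ {c, d, a, b} by simp [Finset.insert_subset_iff])
    rw [hX, Finset.mem_filter]
    refine ⟨hf, ?_⟩
    obtain ⟨hQ, hQcard, hQmax⟩ := hφ _ hf
    have hQD := hQmax {a, c} (by simp [Finset.insert_subset_iff]) hPcard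
    have hmem : φ {a, c, d} ∈ ({a, c, d} : Finset V).powersetCard 2 :=
      Finset.mem_powersetCard.2 ⟨hQ, hQcard⟩
    by_contra hne
    have hdQ : d ∈ φ {a, c, d} := by
      by_contra hdn
      refine hne (Finset.eq_of_subset_of_card_le (fun t ht => ?_) (by rw [hPcard, hQcard]))
      have := hQ ht
      simp only [Finset.mem_insert, Finset.mem_singleton] at this ⊢
      rcases this with h | h | rfl
      · exact Or.inl h
      · exact Or.inr h
      · exact absurd ht hdn
    obtain ⟨t, ht⟩ : ∃ t, (φ {a, c, d}).erase d = {t} := by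
      rw [← Finset.card_eq_one, Finset.card_erase_of_mem hdQ, hQcard]
    have hQt : φ {a, c, d} = {t, d} := by
      rw [← Finset.insert_erase hdQ, ht, Finset.pair_comm]
    have htm : t ∈ (φ {a, c, d}).erase d := ht ▸ Finset.mem_singleton_self t
    rw [Finset.mem_erase] at htm
    have := hQ htm.2
    simp only [Finset.mem_insert, Finset.mem_singleton] at this
    rw [hQt] at hQD
    rcases this with rfl | rfl | h
    · omega
    · omega
    · exact htm.1 h
  set B := N.image fun d => ({a, c, d} : Finset V) with hB
  have hBcard : B.card = N.card := by
    refine Finset.card_image_of_injOn fun d hd d' _ h => ?_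
    have hne := ne_of_mem_link hG (Finset.mem_sdiff.1 hd).1
    have : d ∈ ({a, c, d'} : Finset V) := by
      exact h ▸ (by simp)
    simp only [Finset.mem_insert, Finset.mem_singleton] at this
    tauto
  have hBX : B ⊆ X := fun f hf => by
    obtain ⟨d, hd, rfl⟩ := Finset.mem_image.1 hf
    exact (hheavy d hd).1
  have hXcard : X.card ≤ degree G {a, c} := by
    refine Finset.card_le_card fun f hf => ?_
    rw [Finset.mem_filter] at hf ⊢
    exact ⟨hf.1, hf.2 ▸ (hφ f hf.1).1⟩
  have hNcard : degree G {a, c} ≤ N.card + (S.card + 1) := by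
    have h1 := Finset.le_card_sdiff (insert b S) (link G a c)
    have h2 := Finset.card_insert_le b S
    rw [card_link hG hac, ← hN] at h1
    omega
  have hsd := Finset.card_sdiff_add_card_eq_card hBX
  have hcount : 3 * (X \ B).card ≤ B.card := by omega
  have hsumB : (B.card : ℝ) * (δ / 3) ≤ ∑ f ∈ B, (weight G 3 f - 3 / (m : ℝ)) := by
    rw [← nsmul_eq_mul]
    refine Finset.card_nsmul_le_sum _ _ _ fun f hf => ?_
    obtain ⟨d, hd, rfl⟩ := Finset.mem_image.1 hf
    exact (hheavy d hd).2
  have hsumR : ((X \ B).card : ℝ) * (-δ) ≤ ∑ f ∈ X \ B, (weight G 3 f - 3 / (m : ℝ)) := by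
    rw [← nsmul_eq_mul]
    refine Finset.card_nsmul_le_sum _ _ _ fun f hf => ?_
    have := hemin f (Finset.mem_sdiff.1 hf).1
    linarith
  rw [← Finset.sum_sdiff hBX] at hPneg
  have hcount' : 3 * ((X \ B).card : ℝ) ≤ B.card := by exact_mod_cast hcount
  nlinarith
end

section
/- Let T be a tight 3-tree with t ≥ 5 edges. Suppose T has a trunk {e₁, e₂} of size 2 such that d_T(e₁ ∩ e₂) ≥ ⌊(t−1)/3⌋ + 2. If G is an n-vertex 3-graph that does not contain a copy of T, then e(G) ≤ ((t−1)/3)·|∂(G)|. -/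
open Finset

variable {V : Type*}

section Placement

variable {α : Type*}

/-- The sets `S₁, …, S₄` contain pairwise disjoint subsets of sizes `n₁, …, n₄`. -/
def HasDisjointSubsets (S₁ S₂ S₃ S₄ : Finset α) (n₁ n₂ n₃ n₄ : ℕ) : Prop :=
  ∃ L₁ L₂ L₃ L₄ : Finset α, (L₁ ⊆ S₁ ∧ L₂ ⊆ S₂ ∧ L₃ ⊆ S₃ ∧ L₄ ⊆ S₄) ∧
    (#L₁ = n₁ ∧ #L₂ = n₂ ∧ #L₃ = n₃ ∧ #L₄ = n₄) ∧
    Disjoint L₁ L₂ ∧ Disjoint L₁ L₃ ∧ Disjoint L₁ L₄ ∧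
    Disjoint L₂ L₃ ∧ Disjoint L₂ L₄ ∧ Disjoint L₃ L₄

lemma exists_subset_disjoint_card [DecidableEq α] {S F : Finset α} {n : ℕ} (h : n + #F ≤ #S) :
    ∃ L ⊆ S, Disjoint L F ∧ #L = n := by
  have h1 : n ≤ #(S \ F) := by
    have := Finset.le_card_sdiff F S
    omega
  obtain ⟨L, hL, hc⟩ := Finset.exists_subset_card_eq h1
  rw [Finset.subset_sdiff] at hL
  exact ⟨L, hL.1, hL.2, hc⟩

lemma HasDisjointSubsets.greedy [DecidableEq α] {S₁ S₂ S₃ S₄ : Finset α} {n₁ n₂ n₃ n₄ : ℕ}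
    (h₁ : n₁ ≤ #S₁) (h₂ : n₂ = 0 ∨ n₁ + n₂ ≤ #S₂) (h₃ : n₃ = 0 ∨ n₁ + n₂ + n₃ ≤ #S₃)
    (h₄ : n₄ = 0 ∨ n₁ + n₂ + n₃ + n₄ ≤ #S₄) :
    HasDisjointSubsets S₁ S₂ S₃ S₄ n₁ n₂ n₃ n₄ := by
  have key : ∀ (S F : Finset α) (n : ℕ), (n = 0 ∨ #F + n ≤ #S) →
      ∃ L ⊆ S, Disjoint L F ∧ #L = n := by
    rintro S F n (rfl | h)
    · exact ⟨∅, by simp, by simp, rfl⟩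
    · exact exists_subset_disjoint_card (by omega)
  obtain ⟨L₁, hs₁, -, hc₁⟩ := key S₁ ∅ n₁ (by simp [h₁])
  obtain ⟨L₂, hs₂, hd₂, hc₂⟩ := key S₂ L₁ n₂ (by omega)
  have u₂ := Finset.card_union_le L₁ L₂
  obtain ⟨L₃, hs₃, hd₃, hc₃⟩ := key S₃ (L₁ ∪ L₂) n₃ (by omega)
  have u₃ := Finset.card_union_le (L₁ ∪ L₂) L₃
  obtain ⟨L₄, hs₄, hd₄, hc₄⟩ := key S₄ (L₁ ∪ L₂ ∪ L₃) n₄ (by omega)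
  simp only [Finset.disjoint_union_right] at hd₃ hd₄
  exact ⟨L₁, L₂, L₃, L₄, ⟨hs₁, hs₂, hs₃, hs₄⟩, ⟨hc₁, hc₂, hc₃, hc₄⟩, hd₂.symm, hd₃.1.symm,
    hd₄.1.1.symm, hd₃.2.symm, hd₄.1.2.symm, hd₄.2.symm⟩

lemma HasDisjointSubsets.swap_pairs {S₁ S₂ S₃ S₄ : Finset α} {n₁ n₂ n₃ n₄ : ℕ}
    (h : HasDisjointSubsets S₁ S₂ S₃ S₄ n₁ n₂ n₃ n₄) :
    HasDisjointSubsets S₃ S₄ S₁ S₂ n₃ n₄ n₁ n₂ := by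
  obtain ⟨L₁, L₂, L₃, L₄, ⟨a1, a2, a3, a4⟩, ⟨c1, c2, c3, c4⟩, d1, d2, d3, d4, d5, d6⟩ := h
  exact ⟨L₃, L₄, L₁, L₂, ⟨a3, a4, a1, a2⟩, ⟨c3, c4, c1, c2⟩, d6, d2.symm, d4.symm, d3.symm,
    d5.symm, d1⟩

lemma HasDisjointSubsets.swap_left {S₁ S₂ S₃ S₄ : Finset α} {n₁ n₂ n₃ n₄ : ℕ}
    (h : HasDisjointSubsets S₁ S₂ S₃ S₄ n₁ n₂ n₃ n₄) :
    HasDisjointSubsets S₂ S₁ S₃ S₄ n₂ n₁ n₃ n₄ := by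
  obtain ⟨L₁, L₂, L₃, L₄, ⟨a1, a2, a3, a4⟩, ⟨c1, c2, c3, c4⟩, d1, d2, d3, d4, d5, d6⟩ := h
  exact ⟨L₂, L₁, L₃, L₄, ⟨a2, a1, a3, a4⟩, ⟨c2, c1, c3, c4⟩, d1.symm, d4, d5, d2, d3, d6⟩

lemma HasDisjointSubsets.swap_middle {S₁ S₂ S₃ S₄ : Finset α} {n₁ n₂ n₃ n₄ : ℕ}
    (h : HasDisjointSubsets S₁ S₂ S₃ S₄ n₁ n₂ n₃ n₄) :
    HasDisjointSubsets S₁ S₃ S₂ S₄ n₁ n₃ n₂ n₄ := by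
  obtain ⟨L₁, L₂, L₃, L₄, ⟨a1, a2, a3, a4⟩, ⟨c1, c2, c3, c4⟩, d1, d2, d3, d4, d5, d6⟩ := h
  exact ⟨L₁, L₃, L₂, L₄, ⟨a1, a3, a2, a4⟩, ⟨c1, c3, c2, c4⟩, d2, d1, d3, d4.symm, d6, d5⟩

lemma HasDisjointSubsets.swap_right {S₁ S₂ S₃ S₄ : Finset α} {n₁ n₂ n₃ n₄ : ℕ}
    (h : HasDisjointSubsets S₁ S₂ S₃ S₄ n₁ n₂ n₃ n₄) :
    HasDisjointSubsets S₁ S₂ S₄ S₃ n₁ n₂ n₄ n₃ :=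
  h.swap_pairs.swap_left.swap_pairs

/-- Two small sets `S₁`, `S₂` and two large sets `B₁`, `B₂`: the demands can be met, possibly
after exchanging the two index pairs. -/
lemma HasDisjointSubsets.of_small_large [DecidableEq α] {S₁ B₁ S₂ B₂ : Finset α} {s₁ b₁ s₂ b₂ δ : ℕ}
    (hS₁ : δ ≤ #S₁ + 1) (hS₂ : δ ≤ #S₂ + 1) 
    (hB₁ : s₁ + b₁ + s₂ + b₂ ≤ #B₁) (hB₂ : s₁ + b₁ + s₂ + b₂ ≤ #B₂ + 1)
    (hS : δ ≤ #S₁ ∧ s₁ + b₁ + s₂ + b₂ ≤ #B₂ ∨ δ ≤ #S₂) (hs : s₁ + s₂ ≤ δ) (hsb : s₁ + s₂ ≤ b₁ + b₂) (h₁ : 1 ≤ s₁ + b₁) (h₂ : 1 ≤ s₂ + b₂) :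
    HasDisjointSubsets S₁ B₁ S₂ B₂ s₁ b₁ s₂ b₂ ∨ HasDisjointSubsets S₁ B₁ S₂ B₂ s₂ b₂ s₁ b₁ := by
  have key : ∀ s₁ b₁ s₂ b₂ : ℕ, s₁ + b₁ + s₂ + b₂ ≤ #B₁ → s₁ + b₁ + s₂ + b₂ ≤ #B₂ + 1 →
      (1 ≤ b₁ ∨ s₁ + b₁ + s₂ + b₂ ≤ #B₂) →
      (s₁ ≤ #S₁ ∧ s₁ + s₂ ≤ #S₂ ∨ s₂ ≤ #S₂ ∧ s₁ + s₂ ≤ #S₁) →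
      HasDisjointSubsets S₁ B₁ S₂ B₂ s₁ b₁ s₂ b₂ := by
    rintro s₁ b₁ s₂ b₂ h1 h2 h3 (⟨h4, h5⟩ | ⟨h4, h5⟩)
    · have := HasDisjointSubsets.greedy (S₁ := S₁) (S₂ := S₂) (S₃ := B₂) (S₄ := B₁)
        (n₁ := s₁) (n₂ := s₂) (n₃ := b₂) (n₄ := b₁) (by omega) (by omega) (by omega) (by omega)
      exact this.swap_right.swap_middle
    · have := HasDisjointSubsets.greedy (S₁ := S₂) (S₂ := S₁) (S₃ := B₂) (S₄ := B₁)
        (n₁ := s₂) (n₂ := s₁) (n₃ := b₂) (n₄ := b₁) (by omega) (by omega) (by omega) (by omega)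
      exact this.swap_left.swap_right.swap_middle
  by_cases hx : (1 ≤ b₁ ∨ s₁ + b₁ + s₂ + b₂ ≤ #B₂) ∧
      (s₁ ≤ #S₁ ∧ s₁ + s₂ ≤ #S₂ ∨ s₂ ≤ #S₂ ∧ s₁ + s₂ ≤ #S₁)
  · exact Or.inl (key _ _ _ _ hB₁ hB₂ hx.1 hx.2)
  · exact Or.inr (key _ _ _ _ (by omega) (by omega) (by omega) (by omega))

end Placement

section Embedding

variable {W : Type*} [Fintype W] [DecidableEq W]

/-- `G` contains two edges `XYA`, `XYB` together with `k`, `m₁`, `m₂`, `m₃`, `m₄` further edges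
on the pairs `XY`, `XA`, `YA`, `XB`, `YB`, all with distinct new vertices. -/
def HasDoubleStar (G : Finset (Finset W)) (k m₁ m₂ m₃ m₄ : ℕ) : Prop :=
  ∃ X Y A B : W, A ≠ B ∧ {X, Y, A} ∈ G ∧ {X, Y, B} ∈ G ∧
    ∃ K L₁ L₂ L₃ L₄ : Finset W, K ⊆ nbr G {X, Y} \ {A, B} ∧ #K = k ∧
      (L₁ ⊆ nbr G {X, A} \ {Y, B} ∧ L₂ ⊆ nbr G {Y, A} \ {X, B} ∧
        L₃ ⊆ nbr G {X, B} \ {Y, A} ∧ L₄ ⊆ nbr G {Y, B} \ {X, A}) ∧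
      (#L₁ = m₁ ∧ #L₂ = m₂ ∧ #L₃ = m₃ ∧ #L₄ = m₄) ∧
      (Disjoint L₁ L₂ ∧ Disjoint L₁ L₃ ∧ Disjoint L₁ L₄ ∧
        Disjoint L₂ L₃ ∧ Disjoint L₂ L₄ ∧ Disjoint L₃ L₄) ∧
      Disjoint K L₁ ∧ Disjoint K L₂ ∧ Disjoint K L₃ ∧ Disjoint K L₄

lemma nbr_mono {G H : Finset (Finset W)} (h : G ⊆ H) (B : Finset W) : nbr G B ⊆ nbr H B := by
  intro z
  simp only [nbr, Finset.mem_filter]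
  exact fun hz => ⟨hz.1, hz.2.1, h hz.2.2⟩

lemma HasDoubleStar.mono {G H : Finset (Finset W)} (h : G ⊆ H) {k m₁ m₂ m₃ m₄ : ℕ}
    (hG : HasDoubleStar G k m₁ m₂ m₃ m₄) : HasDoubleStar H k m₁ m₂ m₃ m₄ := by
  obtain ⟨X, Y, A, B, hAB, hA, hB, K, L₁, L₂, L₃, L₄, hK, hk, ⟨h1, h2, h3, h4⟩, r⟩ := hG
  have mono := fun (P Q : Finset W) => Finset.sdiff_subset_sdiff (nbr_mono h P) (subset_refl Q)
  exact ⟨X, Y, A, B, hAB, h hA, h hB, K, L₁, L₂, L₃, L₄, hK.trans (mono _ _), hk,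
    ⟨h1.trans (mono _ _), h2.trans (mono _ _), h3.trans (mono _ _), h4.trans (mono _ _)⟩, r⟩

lemma HasDoubleStar.swap_vertices {G : Finset (Finset W)} {k m₁ m₂ m₃ m₄ : ℕ}
    (hG : HasDoubleStar G k m₁ m₂ m₃ m₄) : HasDoubleStar G k m₂ m₁ m₄ m₃ := by
  obtain ⟨X, Y, A, B, hAB, hA, hB, K, L₁, L₂, L₃, L₄, hK, hk, ⟨a1, a2, a3, a4⟩,
    ⟨c1, c2, c3, c4⟩, ⟨d1, d2, d3, d4, d5, d6⟩, k1, k2, k3, k4⟩ := hG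
  refine ⟨Y, X, A, B, hAB, ?_, ?_, K, L₂, L₁, L₄, L₃, ?_, hk, ⟨a2, a1, a4, a3⟩,
    ⟨c2, c1, c4, c3⟩, ⟨d1.symm, d5, d4, d3, d2, d6.symm⟩, k2, k1, k4, k3⟩
  · rwa [Finset.insert_comm]
  · rwa [Finset.insert_comm]
  · rwa [Finset.pair_comm Y X]

lemma HasDoubleStar.swap_edges {G : Finset (Finset W)} {k m₁ m₂ m₃ m₄ : ℕ}
    (hG : HasDoubleStar G k m₁ m₂ m₃ m₄) : HasDoubleStar G k m₃ m₄ m₁ m₂ := by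
  obtain ⟨X, Y, A, B, hAB, hA, hB, K, L₁, L₂, L₃, L₄, hK, hk, ⟨a1, a2, a3, a4⟩,
    ⟨c1, c2, c3, c4⟩, ⟨d1, d2, d3, d4, d5, d6⟩, k1, k2, k3, k4⟩ := hG
  refine ⟨X, Y, B, A, hAB.symm, hB, hA, K, L₃, L₄, L₁, L₂, ?_, hk, ⟨a3, a4, a1, a2⟩,
    ⟨c3, c4, c1, c2⟩, ⟨d6, d2.symm, d4.symm, d3.symm, d5.symm, d1⟩, k3, k4, k1, k2⟩
  rwa [Finset.pair_comm B A]

lemma HasDoubleStar.of_hasDisjointSubsets {G : Finset (Finset W)} {k m₁ m₂ m₃ m₄ : ℕ}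
    {X Y A B : W} (hAB : A ≠ B) (hA : {X, Y, A} ∈ G) (hB : {X, Y, B} ∈ G)
    (hd : k + m₁ + m₂ + m₃ + m₄ + 2 ≤ #(nbr G {X, Y}))
    (h : HasDisjointSubsets (nbr G {X, A} \ {Y, B}) (nbr G {Y, A} \ {X, B})
      (nbr G {X, B} \ {Y, A}) (nbr G {Y, B} \ {X, A}) m₁ m₂ m₃ m₄) :
    HasDoubleStar G k m₁ m₂ m₃ m₄ := by
  obtain ⟨L₁, L₂, L₃, L₄, hs, hc, hdis⟩ := h
  have u₂ := Finset.card_union_le L₁ L₂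
  have u₃ := Finset.card_union_le (L₁ ∪ L₂) L₃
  have u₄ := Finset.card_union_le (L₁ ∪ L₂ ∪ L₃) L₄
  have hAB2 : #({A, B} : Finset W) ≤ 2 := Finset.card_le_two
  have h2 := Finset.le_card_sdiff ({A, B} : Finset W) (nbr G {X, Y})
  obtain ⟨K, hK, hKd, hk⟩ := exists_subset_disjoint_card (S := nbr G {X, Y} \ {A, B})
    (F := L₁ ∪ L₂ ∪ L₃ ∪ L₄) (n := k) (by omega)
  simp only [Finset.disjoint_union_right] at hKd
  exact ⟨X, Y, A, B, hAB, hA, hB, K, L₁, L₂, L₃, L₄, hK, hk, hs, hc, hdis, hKd.1.1.1,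
    hKd.1.1.2, hKd.1.2, hKd.2⟩

lemma mem_nbr_pair {G : Finset (Finset W)} (hG : ∀ g ∈ G, #g = 3) {X Y Z : W} :
    Z ∈ nbr G {X, Y} ↔ {X, Y, Z} ∈ G := by
  have h : (insert Z {X, Y} : Finset W) = {X, Y, Z} := by
    ext; simp; tauto
  simp only [nbr, Finset.mem_filter, Finset.mem_univ, true_and, h]
  refine ⟨fun h => h.2, fun h' => ⟨fun hZ => ?_, h'⟩⟩
  have := hG _ h'
  rw [← h, Finset.insert_eq_of_mem hZ] at this
  have := Finset.card_le_two (a := X) (b := Y)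
  omega

lemma degree_eq_card_nbr {G : Finset (Finset W)} (hG : ∀ g ∈ G, #g = 3) {D : Finset W}
    (hD : #D = 2) : degree G D = #(nbr G D) := by
  unfold degree
  symm
  refine Finset.card_bij (fun z _ => insert z D) ?_ ?_ ?_
  · intro z hz
    simp only [nbr, Finset.mem_filter] at hz ⊢
    exact ⟨hz.2.2, Finset.subset_insert _ _⟩
  · intro z hz w hw h
    simp only [nbr, Finset.mem_filter] at hz hw
    have : z ∈ insert w D := h ▸ Finset.mem_insert_self z D
    exact (Finset.mem_insert.1 this).resolve_right hz.2.1
  · intro e he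
    simp only [Finset.mem_filter] at he
    have : #(e \ D) = 1 := by
      rw [Finset.card_sdiff_of_subset he.2, hG e he.1, hD]
    obtain ⟨z, hz⟩ := Finset.card_eq_one.1 this
    have hz' : z ∈ e \ D := hz ▸ Finset.mem_singleton_self z
    have hins : insert z D = e := by
      rw [Finset.insert_eq, ← hz, Finset.sdiff_union_of_subset he.2]
    refine ⟨z, ?_, hins⟩
    simp only [nbr, Finset.mem_filter, Finset.mem_univ, true_and, hins]
    exact ⟨(Finset.mem_sdiff.1 hz').2, he.1⟩

omit [Fintype W] in
lemma ne_of_mem {G : Finset (Finset W)} (hG : ∀ g ∈ G, #g = 3) {X Y A : W}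
    (h : {X, Y, A} ∈ G) : X ≠ Y ∧ X ≠ A ∧ Y ≠ A := by
  have h3 := hG _ h
  have h2 : ∀ P Q : W, ({X, Y, A} : Finset W) ≠ {P, Q} := fun P Q he => by
    have := Finset.card_le_two (a := P) (b := Q)
    rw [he] at h3
    omega
  refine ⟨?_, ?_, ?_⟩ <;> rintro rfl
  · exact h2 X A (by simp)
  · exact h2 X Y (by ext; simp; tauto)
  · exact h2 X Y (by simp)

/-- One of the two core edges carries no pendant edges. -/
lemma HasDoubleStar.of_one_sided {G : Finset (Finset W)} (hG : ∀ g ∈ G, #g = 3)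
    {k m₁ m₂ : ℕ} {X Y A : W} (hA : {X, Y, A} ∈ G) (h₁ : m₁ + 1 ≤ #(nbr G {X, A}))
    (h₂ : m₁ + m₂ + 1 ≤ #(nbr G {Y, A})) (hd : m₁ + m₂ + k + 2 ≤ #(nbr G {X, Y})) :
    HasDoubleStar G k m₁ m₂ 0 0 := by
  obtain ⟨hXY, hXA, hYA⟩ := ne_of_mem hG hA
  obtain ⟨L₁, hs₁, hd₁, hc₁⟩ := exists_subset_disjoint_card (S := nbr G {X, A}) (F := {Y})
    (n := m₁) (by simpa using h₁)
  have u₁ := Finset.card_union_le {X} L₁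
  obtain ⟨L₂, hs₂, hd₂, hc₂⟩ := exists_subset_disjoint_card (S := nbr G {Y, A}) (F := {X} ∪ L₁)
    (n := m₂) (by simp only [Finset.card_singleton] at u₁; omega)
  have u₂ := Finset.card_union_le L₁ L₂
  have u₃ := Finset.card_union_le {A} (L₁ ∪ L₂)
  obtain ⟨K', hs, hd, hc⟩ := exists_subset_disjoint_card (S := nbr G {X, Y})
    (F := {A} ∪ (L₁ ∪ L₂)) (n := k + 1) (by simp only [Finset.card_singleton] at u₃; omega)
  obtain ⟨B, hB⟩ : K'.Nonempty := Finset.card_pos.1 (by omega)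
  simp only [Finset.disjoint_union_right, Finset.disjoint_singleton_right] at hd hd₁ hd₂
  have hB₁ : B ∉ L₁ := Finset.disjoint_left.1 hd.2.1 hB
  have hB₂ : B ∉ L₂ := Finset.disjoint_left.1 hd.2.2 hB
  have hsub : ∀ {L S : Finset W} {P Q : W}, L ⊆ S → P ∉ L → Q ∉ L → L ⊆ S \ {P, Q} := by
    intro L S P Q h hP hQ
    simp [Finset.subset_sdiff, h, hP, hQ]
  refine ⟨X, Y, A, B, fun h => hd.1 (h ▸ hB), hA, (mem_nbr_pair hG).1 (hs hB),
    K'.erase B, L₁, L₂, ∅, ∅, hsub ((Finset.erase_subset _ _).trans hs)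
      (fun h => hd.1 (Finset.mem_of_mem_erase h)) (Finset.notMem_erase _ _),
    by rw [Finset.card_erase_of_mem hB, hc]; rfl,
    ⟨hsub hs₁ hd₁ hB₁, hsub hs₂ hd₂.1 hB₂, by simp, by simp⟩, ⟨hc₁, hc₂, rfl, rfl⟩,
    ⟨hd₂.2.symm, by simp, by simp, by simp, by simp, by simp⟩,
    hd.2.1.mono_left (Finset.erase_subset _ _), hd.2.2.mono_left (Finset.erase_subset _ _),
    by simp, by simp⟩

end Embedding

section Numeric

lemma mul_add_lt_of_inv_add_inv_lt {t p q : ℕ} (ht : 2 ≤ t) (hp : 0 < p) (hq : 0 < q)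
    (h : (1 : ℝ) / p + 1 / q < 3 / ((t : ℝ) - 1)) : ((t : ℤ) - 1) * (p + q) < 3 * p * q := by
  have hp' : (0 : ℝ) < p := by exact_mod_cast hp
  have hq' : (0 : ℝ) < q := by exact_mod_cast hq
  have ht' : (0 : ℝ) < (t : ℝ) - 1 := by
    have : (2 : ℝ) ≤ t := by exact_mod_cast ht
    linarith
  rw [div_add_div _ _ hp'.ne' hq'.ne', div_lt_div_iff₀ (by positivity) ht'] at h
  have : ((t : ℝ) - 1) * (p + q) < 3 * p * q := by linarith
  exact_mod_cast this

lemma large_or_balanced {t p q : ℕ} (ht : 5 ≤ t) (hpq : p ≤ q) (hp : (t - 1) / 3 + 1 ≤ p)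
    (h : (1 : ℝ) / p + 1 / q < 3 / ((t : ℝ) - 1)) :
    t ≤ q + (t - 1) / 3 ∨ 2 * ((t - 1) / 3) + 1 ≤ p ∧ 2 * (t - 1) + 1 ≤ 3 * q := by
  have h' := mul_add_lt_of_inv_add_inv_lt (by omega) (by omega) (by omega) h
  obtain ⟨δ, hδ⟩ : ∃ δ, (t - 1) / 3 = δ := ⟨_, rfl⟩
  rw [hδ] at hp ⊢
  obtain ⟨s, hs, rfl⟩ : ∃ s ≤ 2, t = 3 * δ + s + 1 := ⟨t - 1 - 3 * δ, by omega, by omega⟩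
  by_contra! hcon
  obtain ⟨h1, h2⟩ := hcon
  have hq3 : 2 * (3 * δ + s + 1 - 1) + 1 ≤ 3 * q := by
    by_contra hlt
    have e1 : (3 * q : ℤ) ≤ 2 * (3 * δ + s) := by omega
    have e2 : (3 * p : ℤ) ≤ 2 * (3 * δ + s) := by omega
    push_cast at h'
    nlinarith [mul_nonneg (Int.natCast_nonneg p) (sub_nonneg.2 e1),
      mul_nonneg (Int.natCast_nonneg q) (sub_nonneg.2 e2)]
  have hp2 : p ≤ 2 * δ := by
    by_contra hlt
    have := h2 (by omega)
    omega
  have e1 : (0 : ℤ) ≤ 2 * δ - p := by omega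
  have e2 : (0 : ℤ) ≤ 3 * q - (3 * δ + s) := by omega
  have e3 : (0 : ℤ) ≤ 2 * δ + s - q := by omega
  have e4 : (0 : ℤ) ≤ 6 * δ - (3 * δ + s) := by omega
  push_cast at h'
  have hs' : s = 0 ∨ s = 1 ∨ s = 2 := by omega
  rcases hs' with rfl | rfl | rfl <;> push_cast at * <;>
    nlinarith [mul_nonneg e1 e2, mul_nonneg e3 e4]

lemma add_le_of_balanced {t p q d : ℕ} (ht : 5 ≤ t) (hpq : p ≤ q) (hd : t ≤ d)
    (hp : 2 * ((t - 1) / 3) + 1 ≤ p) (hq : q + (t - 1) / 3 + 1 ≤ t) (hq' : 2 * (t - 1) + 1 ≤ 3 * q)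
    (h : (1 : ℝ) / p + 1 / q + 1 / d < 3 / ((t : ℝ) - 1)) : p + q ≤ d := by
  obtain ⟨δ, hδ⟩ : ∃ δ, (t - 1) / 3 = δ := ⟨_, rfl⟩
  rw [hδ] at hp hq
  have hp' : (0 : ℝ) < p := by exact_mod_cast (by omega : 0 < p)
  have hq'' : (0 : ℝ) < q := by exact_mod_cast (by omega : 0 < q)
  have hd' : (0 : ℝ) < d := by exact_mod_cast (by omega : 0 < d)
  have ht' : (0 : ℝ) < (t : ℝ) - 1 := by
    have : (5 : ℝ) ≤ t := by exact_mod_cast ht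
    linarith
  rw [div_add_div _ _ hp'.ne' hq''.ne', div_add_div _ _ (by positivity) hd'.ne',
    div_lt_div_iff₀ (by positivity) ht'] at h
  have h' : (((q + p) * d + p * q : ℤ)) * (t - 1) < 3 * (p * q * d) := by
    have : (((q + p) * d + p * q : ℝ)) * (t - 1) < 3 * (p * q * d) := by linarith
    exact_mod_cast this
  clear h
  by_contra hlt
  have hδ1 : 1 ≤ δ := by omega
  have hcases : (t = 3 * δ + 2 ∧ p = 2 * δ + 1 ∧ q = 2 * δ + 1) ∨
      (t = 3 * δ + 3 ∧ p = 2 * δ + 1 ∧ q = 2 * δ + 2) ∨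
      (t = 3 * δ + 3 ∧ p = 2 * δ + 2 ∧ q = 2 * δ + 2) := by omega
  have hlt' : (d : ℤ) + 1 ≤ p + q := by omega
  rcases hcases with ⟨rfl, rfl, rfl⟩ | ⟨rfl, rfl, rfl⟩ | ⟨rfl, rfl, rfl⟩ <;> push_cast at * <;>
  · have hδ0 : (1 : ℤ) ≤ δ := by omega
    nlinarith [mul_nonneg (sub_nonneg.2 hδ0) (sub_nonneg.2 hlt'),
      mul_nonneg (mul_nonneg (sub_nonneg.2 hδ0) (sub_nonneg.2 hδ0)) (sub_nonneg.2 hδ0),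
      mul_nonneg (sub_nonneg.2 hδ0) (sub_nonneg.2 hδ0)]

end Numeric

section Extension

variable {W : Type*} [Fintype W] [DecidableEq W]

lemma card_nbr_le_sdiff_add_two (G : Finset (Finset W)) (D : Finset W) (P Q : W) :
    #(nbr G D) ≤ #(nbr G D \ {P, Q}) + 2 := by
  have h1 := Finset.le_card_sdiff ({P, Q} : Finset W) (nbr G D)
  have h2 := Finset.card_le_two (a := P) (b := Q)
  omega

lemma card_nbr_le_sdiff_add_one {G : Finset (Finset W)} {D : Finset W} (P : W) {Q : W}
    (hQ : Q ∉ nbr G D) : #(nbr G D) ≤ #(nbr G D \ {P, Q}) + 1 := by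
  have h1 := Finset.le_card_sdiff ({P} : Finset W) (nbr G D)
  have h2 : nbr G D \ {P, Q} = nbr G D \ {P} := by
    ext z
    simp only [Finset.mem_sdiff, Finset.mem_insert, Finset.mem_singleton]
    refine ⟨fun h => ⟨h.1, fun hz => h.2 (Or.inl hz)⟩, fun h => ⟨h.1, ?_⟩⟩
    rintro (hz | rfl)
    · exact h.2 hz
    · exact hQ h.1
  rw [h2]
  simpa using h1

variable {G : Finset (Finset W)} {t k m₁ m₂ m₃ m₄ : ℕ} {X Y A B : W}

/-- An edge with a pair of degree at least `t`, its other two pairs being balanced. -/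
lemma hasDoubleStar_of_balanced (hG : ∀ g ∈ G, #g = 3) (ht : 5 ≤ t)
    (hmin : ∀ P Q R : W, {P, Q, R} ∈ G → (t - 1) / 3 + 1 ≤ #(nbr G {P, Q}))
    (hm : k + m₁ + m₂ + m₃ + m₄ + 2 = t) (hk : (t - 1) / 3 ≤ k) (hA : {X, Y, A} ∈ G)
    (hp : 2 * ((t - 1) / 3) + 1 ≤ #(nbr G {X, A})) (hq : 2 * (t - 1) + 1 ≤ 3 * #(nbr G {Y, A}))
    (hd : t ≤ #(nbr G {X, Y})) (hpq : #(nbr G {X, A}) + #(nbr G {Y, A}) ≤ #(nbr G {X, Y})) :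
    HasDoubleStar G k m₁ m₂ m₃ m₄ := by
  obtain ⟨hXY, hXA, hYA⟩ := ne_of_mem hG hA
  have hYmem : Y ∈ nbr G {X, A} := (mem_nbr_pair hG).2 (by rwa [Finset.pair_comm A Y])
  have hXmem : X ∈ nbr G {Y, A} := (mem_nbr_pair hG).2 (by
    rwa [Finset.pair_comm A X, Finset.insert_comm])
  obtain ⟨B, hB, hBn⟩ : ∃ B ∈ nbr G {X, Y},
      B ∉ insert A ((nbr G {X, A}).erase Y ∪ (nbr G {Y, A}).erase X) := by
    apply Finset.exists_mem_notMem_of_card_lt_card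
    have h1 := Finset.card_insert_le A ((nbr G {X, A}).erase Y ∪ (nbr G {Y, A}).erase X)
    have h2 := Finset.card_union_le ((nbr G {X, A}).erase Y) ((nbr G {Y, A}).erase X)
    have h3 := Finset.card_erase_of_mem hYmem
    have h4 := Finset.card_erase_of_mem hXmem
    have h5 := Finset.card_pos.2 ⟨_, hYmem⟩
    have h6 := Finset.card_pos.2 ⟨_, hXmem⟩
    omega
  have hB' := (mem_nbr_pair hG).1 hB
  obtain ⟨-, hXB, hYB⟩ := ne_of_mem hG hB'
  simp only [Finset.mem_insert, Finset.mem_union, Finset.mem_erase, not_or, not_and] at hBn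
  obtain ⟨hBA, hB1, hB2⟩ := hBn
  have n1 := hB1 hYB.symm
  have n2 := hB2 hXB.symm
  have n3 : A ∉ nbr G {X, B} := by
    rw [mem_nbr_pair hG] at n1 ⊢
    rwa [Finset.pair_comm B A]
  have n4 : A ∉ nbr G {Y, B} := by
    rw [mem_nbr_pair hG] at n2 ⊢
    rwa [Finset.pair_comm B A]
  have c1 := card_nbr_le_sdiff_add_one Y n1
  have c2 := card_nbr_le_sdiff_add_one X n2
  have c3 := card_nbr_le_sdiff_add_one Y n3
  have c4 := card_nbr_le_sdiff_add_one X n4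
  have d3 := hmin X B Y (by rwa [Finset.pair_comm B Y])
  have d4 := hmin Y B X (by rwa [Finset.pair_comm B X, Finset.insert_comm])
  have key : ∀ n₁ n₂ n₃ n₄ : ℕ, k + n₁ + n₂ + n₃ + n₄ + 2 = t → n₃ + n₄ ≤ (t - 1) / 3 →
      n₁ + n₃ + n₄ ≤ 2 * ((t - 1) / 3) → HasDoubleStar G k n₁ n₂ n₃ n₄ := by
    intro n₁ n₂ n₃ n₄ h1 h2 h3
    refine .of_hasDisjointSubsets (fun h => hBA h.symm) hA hB' (by omega) ?_
    apply HasDisjointSubsets.swap_pairs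
    exact .greedy (by omega) (by omega) (by omega) (by omega)
  by_cases h34 : m₃ + m₄ ≤ (t - 1) / 3
  · by_cases h1 : m₁ + m₃ + m₄ ≤ 2 * ((t - 1) / 3)
    · exact key _ _ _ _ hm h34 h1
    · exact (key m₂ m₁ m₄ m₃ (by omega) (by omega) (by omega)).swap_vertices
  · apply HasDoubleStar.swap_edges
    by_cases h1 : m₃ + m₁ + m₂ ≤ 2 * ((t - 1) / 3)
    · exact key _ _ _ _ (by omega) (by omega) h1
    · exact (key m₄ m₃ m₂ m₁ (by omega) (by omega) (by omega)).swap_vertices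

/-- Two edges `XYA`, `XYB`, the pair `YA` being large: either there is a double star, or the
smaller remaining pairs have the least possible degree. -/
lemma exceptional_of_two_edges (hG : ∀ g ∈ G, #g = 3) (ht : 5 ≤ t)
    (hmin : ∀ P Q R : W, {P, Q, R} ∈ G → (t - 1) / 3 + 1 ≤ #(nbr G {P, Q}))
    (hm : k + m₁ + m₂ + m₃ + m₄ + 2 = t) (hk : (t - 1) / 3 ≤ k)
    (h12 : 1 ≤ m₁ + m₂) (h34 : 1 ≤ m₃ + m₄) (hno : ¬ HasDoubleStar G k m₁ m₂ m₃ m₄)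
    (hAB : A ≠ B) (hA : {X, Y, A} ∈ G) (hB : {X, Y, B} ∈ G)
    (hq : t ≤ #(nbr G {Y, A}) + (t - 1) / 3) (hd : t ≤ #(nbr G {X, Y}))
    (hf : t ≤ #(nbr G {X, B}) ∨ t ≤ #(nbr G {Y, B}) ∨
      (1 : ℝ) / #(nbr G {X, B}) + 1 / #(nbr G {Y, B}) < 3 / ((t : ℝ) - 1)) :
    {X, A, B} ∈ G ∧ #(nbr G {X, A}) = (t - 1) / 3 + 1 ∧
      (#(nbr G {X, B}) = (t - 1) / 3 + 1 ∨ #(nbr G {Y, B}) = (t - 1) / 3 + 1) := by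
  have c1 := card_nbr_le_sdiff_add_two G {X, A} Y B
  have c2 := card_nbr_le_sdiff_add_two G {Y, A} X B
  have c3 := card_nbr_le_sdiff_add_two G {X, B} Y A
  have c4 := card_nbr_le_sdiff_add_two G {Y, B} X A
  have d1 := hmin X A Y (by rwa [Finset.pair_comm A Y])
  have d3 := hmin X B Y (by rwa [Finset.pair_comm B Y])
  have d4 := hmin Y B X (by rwa [Finset.pair_comm B X, Finset.insert_comm])
  have c1' : {X, A, B} ∉ G → #(nbr G {X, A}) ≤ #(nbr G {X, A} \ {Y, B}) + 1 := fun h =>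
    card_nbr_le_sdiff_add_one Y (by rwa [mem_nbr_pair hG])
  have build : ∀ n₁ n₂ n₃ n₄ : ℕ, k + n₁ + n₂ + n₃ + n₄ + 2 = t →
      HasDisjointSubsets (nbr G {X, A} \ {Y, B}) (nbr G {Y, A} \ {X, B})
        (nbr G {X, B} \ {Y, A}) (nbr G {Y, B} \ {X, A}) n₁ n₂ n₃ n₄ →
      HasDoubleStar G k n₁ n₂ n₃ n₄ := fun n₁ n₂ n₃ n₄ h1 h2 =>
    .of_hasDisjointSubsets hAB hA hB (by omega) h2
  by_contra hex
  have hbig : (t ≤ #(nbr G {Y, B}) + (t - 1) / 3 ∨ 2 * ((t - 1) / 3) + 1 ≤ #(nbr G {X, B}) ∧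
        2 * (t - 1) + 1 ≤ 3 * #(nbr G {Y, B})) ∨
      (t ≤ #(nbr G {X, B}) + (t - 1) / 3 ∨ 2 * ((t - 1) / 3) + 1 ≤ #(nbr G {Y, B}) ∧
        2 * (t - 1) + 1 ≤ 3 * #(nbr G {X, B})) := by
    rcases hf with hf | hf | hf
    · exact Or.inr (Or.inl (by omega))
    · exact Or.inl (Or.inl (by omega))
    · rcases le_total #(nbr G {X, B}) #(nbr G {Y, B}) with hle | hle
      · exact Or.inl (large_or_balanced ht hle d3 hf)
      · exact Or.inr (large_or_balanced ht hle d4 (by rwa [add_comm] at hf))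
  have hsmall : (t - 1) / 3 ≤ #(nbr G {X, A} \ {Y, B}) ∨
      (t - 1) / 3 + 2 ≤ #(nbr G {X, B}) ∧ (t - 1) / 3 + 2 ≤ #(nbr G {Y, B}) := by
    by_contra hcon
    refine hex ⟨?_, by omega, by omega⟩
    by_contra hXAB
    have := c1' hXAB
    omega
  apply hno
  rcases hbig with hbig | hbig
  · have key : ∀ n₁ n₂ n₃ n₄ : ℕ, k + n₁ + n₂ + n₃ + n₄ + 2 = t → 1 ≤ n₁ + n₂ → 1 ≤ n₃ + n₄ →
        n₁ + n₃ ≤ n₂ + n₄ → HasDoubleStar G k n₁ n₂ n₃ n₄ := by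
      intro n₁ n₂ n₃ n₄ h1 h2 h3 h4
      rcases HasDisjointSubsets.of_small_large (δ := (t - 1) / 3)
        (S₁ := nbr G {X, A} \ {Y, B}) (B₁ := nbr G {Y, A} \ {X, B})
        (S₂ := nbr G {X, B} \ {Y, A}) (B₂ := nbr G {Y, B} \ {X, A})
        (s₁ := n₁) (b₁ := n₂) (s₂ := n₃) (b₂ := n₄)
        (by omega) (by omega) (by omega) (by omega) (by omega) (by omega) (by omega) (by omega)
        (by omega) with h | h
      · exact build _ _ _ _ h1 h
      · exact (build _ _ _ _ (by omega) h).swap_edges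
    by_cases hs : m₁ + m₃ ≤ m₂ + m₄
    · exact key _ _ _ _ hm h12 h34 hs
    · exact (key m₂ m₁ m₄ m₃ (by omega) (by omega) (by omega) (by omega)).swap_vertices
  · have key : ∀ n₁ n₂ n₃ n₄ : ℕ, k + n₁ + n₂ + n₃ + n₄ + 2 = t → 1 ≤ n₁ + n₂ → 1 ≤ n₃ + n₄ →
        n₁ + n₄ ≤ n₂ + n₃ → HasDoubleStar G k n₁ n₂ n₃ n₄ := by
      intro n₁ n₂ n₃ n₄ h1 h2 h3 h4
      rcases HasDisjointSubsets.of_small_large (δ := (t - 1) / 3)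
        (S₁ := nbr G {X, A} \ {Y, B}) (B₁ := nbr G {Y, A} \ {X, B})
        (S₂ := nbr G {Y, B} \ {X, A}) (B₂ := nbr G {X, B} \ {Y, A})
        (s₁ := n₁) (b₁ := n₂) (s₂ := n₄) (b₂ := n₃)
        (by omega) (by omega) (by omega) (by omega) (by omega) (by omega) (by omega) (by omega)
        (by omega) with h | h
      · exact build _ _ _ _ h1 h.swap_right
      · exact (build _ _ _ _ (by omega) h.swap_right).swap_vertices.swap_edges
    by_cases hs : m₁ + m₄ ≤ m₂ + m₃
    · exact key _ _ _ _ hm h12 h34 hs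
    · exact (key m₂ m₁ m₄ m₃ (by omega) (by omega) (by omega) (by omega)).swap_vertices

/-- The analysis of the edges `XYB` on the pair `XY` of largest degree in a light edge `XYA`. -/
lemma exceptional_of_light_edge (hG : ∀ g ∈ G, #g = 3) (ht : 5 ≤ t)
    (hmin : ∀ P Q R : W, {P, Q, R} ∈ G → (t - 1) / 3 + 1 ≤ #(nbr G {P, Q}))
    (hm : k + m₁ + m₂ + m₃ + m₄ + 2 = t) (hk : (t - 1) / 3 ≤ k)
    (hno : ¬ HasDoubleStar G k m₁ m₂ m₃ m₄) (hA : {X, Y, A} ∈ G)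
    (hpq : #(nbr G {X, A}) ≤ #(nbr G {Y, A})) (hd : t ≤ #(nbr G {X, Y}))
    (he : (1 : ℝ) / #(nbr G {X, A}) + 1 / #(nbr G {Y, A}) + 1 / #(nbr G {X, Y})
      < 3 / ((t : ℝ) - 1)) (hAB : A ≠ B) (hB : {X, Y, B} ∈ G)
    (hf : t ≤ #(nbr G {X, B}) ∨ t ≤ #(nbr G {Y, B}) ∨
      (1 : ℝ) / #(nbr G {X, B}) + 1 / #(nbr G {Y, B}) < 3 / ((t : ℝ) - 1)) :
    {X, A, B} ∈ G ∧ #(nbr G {X, A}) = (t - 1) / 3 + 1 ∧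
      (#(nbr G {X, B}) = (t - 1) / 3 + 1 ∨ #(nbr G {Y, B}) = (t - 1) / 3 + 1) := by
  have d1 := hmin X A Y (by rwa [Finset.pair_comm A Y])
  have he' : (1 : ℝ) / #(nbr G {X, A}) + 1 / #(nbr G {Y, A}) < 3 / ((t : ℝ) - 1) := by
    have : (0 : ℝ) ≤ 1 / #(nbr G {X, Y}) := by positivity
    linarith
  have hlb := large_or_balanced ht hpq d1 he'
  have hone : ∀ n₁ n₂ : ℕ, k + n₁ + n₂ + 2 = t → HasDoubleStar G k n₁ n₂ 0 0 := by
    intro n₁ n₂ h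
    by_cases hle : n₁ ≤ n₂
    · exact .of_one_sided hG hA (by omega) (by omega) (by omega)
    · exact (HasDoubleStar.of_one_sided hG hA (m₁ := n₂) (m₂ := n₁) (by omega) (by omega)
        (by omega)).swap_vertices
  have h34 : 1 ≤ m₃ + m₄ := by
    by_contra h0
    obtain ⟨rfl, rfl⟩ : m₃ = 0 ∧ m₄ = 0 := by omega
    exact hno (hone _ _ hm)
  have h12 : 1 ≤ m₁ + m₂ := by
    by_contra h0
    obtain ⟨rfl, rfl⟩ : m₁ = 0 ∧ m₂ = 0 := by omega
    exact hno (hone _ _ (by omega)).swap_edges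
  have hq : t ≤ #(nbr G {Y, A}) + (t - 1) / 3 := by
    by_contra hq
    obtain ⟨hp, hq3⟩ := hlb.resolve_left hq
    exact hno (hasDoubleStar_of_balanced hG ht hmin hm hk hA hp hq3 hd
      (add_le_of_balanced ht hpq hd hp (by omega) hq3 he))
  exact exceptional_of_two_edges hG ht hmin hm hk h12 h34 hno hAB hA hB hq hd hf

end Extension

section Weights

lemma powersetCard_two_triple {W : Type*} [DecidableEq W] {X Y A : W} (hXY : X ≠ Y) (hXA : X ≠ A)
    (hYA : Y ≠ A) :
    ({X, Y, A} : Finset W).powersetCard 2 = {{X, Y}, {X, A}, {Y, A}} := by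
  symm
  apply Finset.eq_of_subset_of_card_le
  · intro D hD
    simp only [Finset.mem_insert, Finset.mem_singleton] at hD
    rw [Finset.mem_powersetCard]
    rcases hD with rfl | rfl | rfl
    · exact ⟨by intro z; simp; tauto, Finset.card_pair hXY⟩
    · exact ⟨by intro z; simp; tauto, Finset.card_pair hXA⟩
    · exact ⟨by intro z; simp; tauto, Finset.card_pair hYA⟩
  · have h3 : #({X, Y, A} : Finset W) = 3 := Finset.card_eq_three.2 ⟨X, Y, A, hXY, hXA, hYA, rfl⟩
    have h1 : ({X, Y} : Finset W) ∉ ({{X, A}, {Y, A}} : Finset (Finset W)) := by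
      simp only [Finset.mem_insert, Finset.mem_singleton, not_or]
      refine ⟨fun h => ?_, fun h => ?_⟩
      · have : Y ∈ ({X, A} : Finset W) := h ▸ by simp
        simp [hXY.symm, hYA] at this
      · have : X ∈ ({Y, A} : Finset W) := h ▸ by simp
        simp [hXY, hXA] at this
    have h2 : ({X, A} : Finset W) ≠ {Y, A} := fun h => by
      have : X ∈ ({Y, A} : Finset W) := h ▸ by simp
      simp [hXY, hXA] at this
    rw [Finset.card_powersetCard, h3, Finset.card_insert_of_notMem h1, Finset.card_pair h2]
    decide

lemma pair_ne_pair {W : Type*} [DecidableEq W] {X Y A : W} (hXA : X ≠ A) (hYA : Y ≠ A) (Z : W) :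
    ({Z, A} : Finset W) ≠ {X, Y} := fun h => by
  have : A ∈ ({X, Y} : Finset W) := h ▸ by simp
  simp [hXA.symm, hYA.symm] at this

variable {W : Type*} [Fintype W] [DecidableEq W]

omit [Fintype W] in
lemma exists_eq_triple {G : Finset (Finset W)} (hG : ∀ g ∈ G, #g = 3) {f : Finset W} (hf : f ∈ G)
    {X Y : W} (hXY : X ≠ Y) (hD : {X, Y} ⊆ f) : ∃ B, f = {X, Y, B} := by
  have h1 : #(f \ {X, Y}) = 1 := by
    rw [Finset.card_sdiff_of_subset hD, hG f hf, Finset.card_pair hXY]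
  obtain ⟨B, hB⟩ := Finset.card_eq_one.1 h1
  refine ⟨B, ?_⟩
  rw [← Finset.sdiff_union_of_subset hD, hB]
  ext z
  simp
  tauto

lemma weight_triple_s9 {G : Finset (Finset W)} (hG : ∀ g ∈ G, #g = 3) {X Y A : W}
    (h : {X, Y, A} ∈ G) :
    weight G 3 {X, Y, A} = 1 / #(nbr G {X, Y}) + 1 / #(nbr G {X, A}) + 1 / #(nbr G {Y, A}) := by
  obtain ⟨hXY, hXA, hYA⟩ := ne_of_mem hG h
  have h1 : ({X, Y} : Finset W) ∉ ({{X, A}, {Y, A}} : Finset (Finset W)) := by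
    simp [(pair_ne_pair hXA hYA X).symm, (pair_ne_pair hXA hYA Y).symm]
  have h2 : ({X, A} : Finset W) ≠ {Y, A} := fun h => by
    have : X ∈ ({Y, A} : Finset W) := h ▸ by simp
    simp [hXY, hXA] at this
  rw [weight, powersetCard_two_triple hXY hXA hYA, Finset.sum_insert h1, Finset.sum_pair h2,
    degree_eq_card_nbr hG (Finset.card_pair hXY), degree_eq_card_nbr hG (Finset.card_pair hXA),
    degree_eq_card_nbr hG (Finset.card_pair hYA), add_assoc]

/-- A pair of degree at least `t` contained in an edge of weight below `3 / (t - 1)`. -/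
def IsSpecial (G : Finset (Finset W)) (t : ℕ) (D : Finset W) : Prop :=
  t ≤ degree G D ∧ ∃ e ∈ G, D ⊆ e ∧ weight G 3 e < 3 / ((t : ℝ) - 1)

open Classical in
/-- The edges containing `D` which need a share of the pair `D`. -/
noncomputable def recipients (G : Finset (Finset W)) (t : ℕ) (D : Finset W) :
    Finset (Finset W) :=
  G.filter fun f => D ⊆ f ∧ (weight G 3 f - 1 / degree G D < 3 / ((t : ℝ) - 1) ∨
    ∃ D' ∈ f.powersetCard 2, D' ≠ D ∧ t ≤ degree G D')

open Classical in
/-- The share of the edge `f` in the unit weight of the pair `D`. -/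
noncomputable def share (G : Finset (Finset W)) (t : ℕ) (D f : Finset W) : ℝ :=
  if IsSpecial G t D then
    if f ∈ recipients G t D then 1 / #(recipients G t D) else 0
  else 1 / degree G D

omit [Fintype W] in
lemma share_nonneg (G : Finset (Finset W)) (t : ℕ) (D f : Finset W) : 0 ≤ share G t D f := by
  unfold share
  split_ifs <;> positivity

omit [Fintype W] in
lemma share_of_not_isSpecial {G : Finset (Finset W)} {t : ℕ} {D : Finset W}
    (h : ¬ IsSpecial G t D) (f : Finset W) : share G t D f = 1 / degree G D := by
  simp [share, h]

omit [Fintype W] in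
lemma sum_share_le_one (G : Finset (Finset W)) (t : ℕ) (D : Finset W) :
    ∑ f ∈ G with D ⊆ f, share G t D f ≤ 1 := by
  classical
  by_cases h : IsSpecial G t D
  · have hsub : recipients G t D ⊆ G.filter fun f => D ⊆ f := by
      intro f hf
      simp only [recipients, Finset.mem_filter] at hf ⊢
      exact ⟨hf.1, hf.2.1⟩
    simp only [share, h, if_true]
    rw [Finset.sum_ite_mem, Finset.inter_eq_right.2 hsub, Finset.sum_const, nsmul_eq_mul,
      mul_one_div]
    exact div_self_le_one _
  · simp only [share_of_not_isSpecial h]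
    rw [Finset.sum_const, nsmul_eq_mul, mul_one_div]
    exact div_self_le_one _

variable {G : Finset (Finset W)} {t k m₁ m₂ m₃ m₄ : ℕ}

lemma recipients_structure (hG : ∀ g ∈ G, #g = 3) (ht : 5 ≤ t)
    (hmin : ∀ P Q R : W, {P, Q, R} ∈ G → (t - 1) / 3 + 1 ≤ #(nbr G {P, Q}))
    (hm : k + m₁ + m₂ + m₃ + m₄ + 2 = t) (hk : (t - 1) / 3 ≤ k)
    (hno : ¬ HasDoubleStar G k m₁ m₂ m₃ m₄) {D f : Finset W} (hD2 : #D = 2)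
    (hD : IsSpecial G t D) (hf : f ∈ recipients G t D) :
    #(recipients G t D) = 1 ∨ #(recipients G t D) ≤ (t - 1) / 3 + 1 ∧
      ∃ D' ∈ f.powersetCard 2, D' ≠ D ∧ degree G D' = (t - 1) / 3 + 1 := by
  obtain ⟨hd, e, he, hDe, hw⟩ := hD
  rw [degree_eq_card_nbr hG hD2] at hd
  obtain ⟨X, Y, A, rfl, rfl, hpq⟩ : ∃ X Y A, D = {X, Y} ∧ e = {X, Y, A} ∧
      #(nbr G {X, A}) ≤ #(nbr G {Y, A}) := by
    obtain ⟨X, Y, hXY, rfl⟩ := Finset.card_eq_two.1 hD2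
    obtain ⟨A, rfl⟩ := exists_eq_triple hG he hXY hDe
    rcases le_total #(nbr G {X, A}) #(nbr G {Y, A}) with h | h
    · exact ⟨X, Y, A, rfl, rfl, h⟩
    · exact ⟨Y, X, A, Finset.pair_comm _ _, Finset.insert_comm _ _ _, h⟩
  obtain ⟨hXY, hXA, hYA⟩ := ne_of_mem hG he
  rw [weight_triple_s9 hG he] at hw
  have main : ∀ g ∈ recipients G t {X, Y}, g ≠ {X, Y, A} → ∃ B, g = {X, Y, B} ∧
      X ≠ B ∧ Y ≠ B ∧ {X, A, B} ∈ G ∧ #(nbr G {X, A}) = (t - 1) / 3 + 1 ∧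
      (#(nbr G {X, B}) = (t - 1) / 3 + 1 ∨ #(nbr G {Y, B}) = (t - 1) / 3 + 1) := by
    intro g hg hne
    simp only [recipients, Finset.mem_filter] at hg
    obtain ⟨hgG, hDg, hg⟩ := hg
    obtain ⟨B, rfl⟩ := exists_eq_triple hG hgG hXY hDg
    obtain ⟨-, hXB, hYB⟩ := ne_of_mem hG hgG
    refine ⟨B, rfl, hXB, hYB, exceptional_of_light_edge hG ht hmin hm hk hno he hpq hd
      (by linarith) (by rintro rfl; exact hne rfl) hgG ?_⟩
    rcases hg with hg | ⟨D', hD', hne', hdeg⟩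
    · rw [weight_triple_s9 hG hgG, degree_eq_card_nbr hG (Finset.card_pair hXY)] at hg
      exact Or.inr (Or.inr (by linarith))
    · rw [powersetCard_two_triple hXY hXB hYB] at hD'
      simp only [Finset.mem_insert, Finset.mem_singleton] at hD'
      rcases hD' with rfl | rfl | rfl
      · exact absurd rfl hne'
      · rw [degree_eq_card_nbr hG (Finset.card_pair hXB)] at hdeg
        exact Or.inl hdeg
      · rw [degree_eq_card_nbr hG (Finset.card_pair hYB)] at hdeg
        exact Or.inr (Or.inl hdeg)
  by_cases hex : ∃ g ∈ recipients G t {X, Y}, g ≠ {X, Y, A}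
  · right
    obtain ⟨g, hg, hne⟩ := hex
    obtain ⟨-, -, -, -, -, hp, -⟩ := main g hg hne
    constructor
    · have hsub : recipients G t {X, Y} ⊆ insert {X, Y, A}
          (((nbr G {X, A}).erase Y).image fun B => {X, Y, B}) := by
        intro g hg
        by_cases hne : g = {X, Y, A}
        · rw [hne]
          exact Finset.mem_insert_self _ _
        · obtain ⟨B, rfl, -, hYB, hXAB, -⟩ := main g hg hne
          refine Finset.mem_insert_of_mem (Finset.mem_image.2 ⟨B, ?_, rfl⟩)
          exact Finset.mem_erase.2 ⟨hYB.symm, (mem_nbr_pair hG).2 hXAB⟩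
      have hY : Y ∈ nbr G {X, A} := (mem_nbr_pair hG).2 (by rwa [Finset.pair_comm A Y])
      have h1 := Finset.card_le_card hsub
      have h2 := Finset.card_insert_le ({X, Y, A} : Finset W)
        (((nbr G {X, A}).erase Y).image fun B => {X, Y, B})
      have h3 := Finset.card_image_le (s := (nbr G {X, A}).erase Y)
        (f := fun B => ({X, Y, B} : Finset W))
      have h4 := Finset.card_erase_of_mem hY
      omega
    · by_cases hne : f = {X, Y, A}
      · subst hne
        refine ⟨{X, A}, ?_, pair_ne_pair hXA hYA X, ?_⟩
        · rw [powersetCard_two_triple hXY hXA hYA]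
          simp
        · rw [degree_eq_card_nbr hG (Finset.card_pair hXA), hp]
      · obtain ⟨B, rfl, hXB, hYB, -, -, h⟩ := main f hf hne
        rw [powersetCard_two_triple hXY hXB hYB]
        rcases h with h | h
        · refine ⟨{X, B}, by simp, pair_ne_pair hXB hYB X, ?_⟩
          rw [degree_eq_card_nbr hG (Finset.card_pair hXB), h]
        · refine ⟨{Y, B}, by simp, pair_ne_pair hXB hYB Y, ?_⟩
          rw [degree_eq_card_nbr hG (Finset.card_pair hYB), h]
  · left
    push Not at hex
    exact Finset.card_eq_one.2 ⟨_, Finset.eq_singleton_iff_unique_mem.2 ⟨hex f hf ▸ hf, hex⟩⟩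

lemma le_sum_share (hG : ∀ g ∈ G, #g = 3) (ht : 5 ≤ t)
    (hmin : ∀ P Q R : W, {P, Q, R} ∈ G → (t - 1) / 3 + 1 ≤ #(nbr G {P, Q}))
    (hm : k + m₁ + m₂ + m₃ + m₄ + 2 = t) (hk : (t - 1) / 3 ≤ k)
    (hno : ¬ HasDoubleStar G k m₁ m₂ m₃ m₄) {f : Finset W} (hf : f ∈ G) :
    3 / ((t : ℝ) - 1) ≤ ∑ D ∈ f.powersetCard 2, share G t D f := by
  have ht' : (5 : ℝ) ≤ t := by exact_mod_cast ht
  by_cases hsp : ∃ D ∈ f.powersetCard 2, IsSpecial G t D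
  · obtain ⟨D, hD, hDsp⟩ := hsp
    have hD2 := (Finset.mem_powersetCard.1 hD).2
    by_cases hrec : f ∈ recipients G t D
    · have hshare : share G t D f = 1 / #(recipients G t D) := by simp [share, hDsp, hrec]
      rcases recipients_structure hG ht hmin hm hk hno hD2 hDsp hrec with h | ⟨h, D', hD', hne, hdeg⟩
      · have h1 := Finset.single_le_sum (f := fun D => share G t D f)
          (fun D _ => share_nonneg G t D f) hD
        simp only [hshare, h, Nat.cast_one, div_one] at h1
        refine le_trans ?_ h1
        rw [div_le_one (by linarith)]
        linarith
      · have hns : ¬ IsSpecial G t D' := fun h => by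
          have := h.1
          omega
        have h1 : ∑ E ∈ {D, D'}, share G t E f ≤ ∑ E ∈ f.powersetCard 2, share G t E f := by
          apply Finset.sum_le_sum_of_subset_of_nonneg
          · intro E hE
            simp only [Finset.mem_insert, Finset.mem_singleton] at hE
            rcases hE with rfl | rfl <;> assumption
          · exact fun _ _ _ => share_nonneg _ _ _ _
        rw [Finset.sum_pair hne.symm, hshare, share_of_not_isSpecial hns, hdeg] at h1
        refine le_trans ?_ h1
        have hpos : 0 < #(recipients G t D) := Finset.card_pos.2 ⟨f, hrec⟩
        have hpos' : (0 : ℝ) < #(recipients G t D) := by exact_mod_cast hpos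
        have h2 : (1 : ℝ) / (((t - 1) / 3 + 1 : ℕ) : ℝ) ≤ 1 / #(recipients G t D) :=
          one_div_le_one_div_of_le hpos' (by exact_mod_cast h)
        have h3 : 3 / ((t : ℝ) - 1) ≤ 2 * (1 / (((t - 1) / 3 + 1 : ℕ) : ℝ)) := by
          rw [mul_one_div, div_le_div_iff₀ (by linarith) (by positivity)]
          have : 3 * ((t - 1) / 3 + 1) + 2 ≤ 2 * t := by omega
          have : (3 * (((t - 1) / 3 + 1 : ℕ) : ℝ) + 2) ≤ 2 * t := by exact_mod_cast this
          linarith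
        linarith
    · have hrec' : ¬ (weight G 3 f - 1 / degree G D < 3 / ((t : ℝ) - 1) ∨
          ∃ D' ∈ f.powersetCard 2, D' ≠ D ∧ t ≤ degree G D') := fun h => hrec (by
        simp only [recipients, Finset.mem_filter]
        exact ⟨hf, (Finset.mem_powersetCard.1 hD).1, h⟩)
      push Not at hrec'
      obtain ⟨h1, h2⟩ := hrec'
      have h3 : weight G 3 f - 1 / degree G D =
          ∑ E ∈ (f.powersetCard 2).erase D, (1 : ℝ) / degree G E := by
        rw [weight, ← Finset.add_sum_erase _ _ hD]
        ring
      rw [h3] at h1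
      refine h1.trans ?_
      rw [← Finset.add_sum_erase _ _ hD]
      have h4 : ∑ E ∈ (f.powersetCard 2).erase D, (1 : ℝ) / degree G E =
          ∑ E ∈ (f.powersetCard 2).erase D, share G t E f := by
        refine Finset.sum_congr rfl fun E hE => (share_of_not_isSpecial (fun hs => ?_) f).symm
        have := h2 E (Finset.mem_of_mem_erase hE) (Finset.ne_of_mem_erase hE)
        have := hs.1
        omega
      rw [h4]
      linarith [share_nonneg G t D f]
  · push Not at hsp
    rw [Finset.sum_congr rfl fun D hD => share_of_not_isSpecial (hsp D hD) f]
    by_contra! hlt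
    have hsmall : ∀ D ∈ f.powersetCard 2, 1 / ((t : ℝ) - 1) ≤ 1 / degree G D := by
      intro D hD
      have hDf := (Finset.mem_powersetCard.1 hD).1
      have hpos : 0 < degree G D := Finset.card_pos.2 ⟨f, Finset.mem_filter.2 ⟨hf, hDf⟩⟩
      have hdt : ¬ t ≤ degree G D := fun h => hsp D hD ⟨h, f, hf, hDf, hlt⟩
      apply one_div_le_one_div_of_le (by exact_mod_cast hpos)
      have : degree G D + 1 ≤ t := by omega
      have : ((degree G D : ℝ) + 1) ≤ t := by exact_mod_cast this
      linarith
    have h1 := Finset.card_nsmul_le_sum _ _ _ hsmall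
    rw [Finset.card_powersetCard, hG f hf, nsmul_eq_mul] at h1
    have h2 : ((Nat.choose 3 2 : ℕ) : ℝ) * (1 / ((t : ℝ) - 1)) = 3 / ((t : ℝ) - 1) := by
      norm_num [Nat.choose]
      ring
    linarith

lemma card_le_of_min_degree (hG : ∀ g ∈ G, #g = 3) (ht : 5 ≤ t)
    (hmin : ∀ P Q R : W, {P, Q, R} ∈ G → (t - 1) / 3 + 1 ≤ #(nbr G {P, Q}))
    (hm : k + m₁ + m₂ + m₃ + m₄ + 2 = t) (hk : (t - 1) / 3 ≤ k)
    (hno : ¬ HasDoubleStar G k m₁ m₂ m₃ m₄) :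
    (#G : ℝ) ≤ ((t : ℝ) - 1) / 3 * #(hshadow G 3) := by
  have ht' : (5 : ℝ) ≤ t := by exact_mod_cast ht
  have h1 : (#G : ℝ) * (3 / ((t : ℝ) - 1)) ≤ #(hshadow G 3) := by
    calc (#G : ℝ) * (3 / ((t : ℝ) - 1))
        = ∑ f ∈ G, 3 / ((t : ℝ) - 1) := by rw [Finset.sum_const, nsmul_eq_mul]
      _ ≤ ∑ f ∈ G, ∑ D ∈ f.powersetCard 2, share G t D f :=
        Finset.sum_le_sum fun f hf => le_sum_share hG ht hmin hm hk hno hf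
      _ = ∑ D ∈ hshadow G 3, ∑ f ∈ G with D ⊆ f, share G t D f := by
        refine Finset.sum_comm' fun f D => ?_
        simp only [hshadow, Finset.mem_biUnion, Finset.mem_powersetCard, Finset.mem_filter]
        constructor
        · rintro ⟨hf, hD, hc⟩
          exact ⟨⟨hf, hD⟩, f, hf, hD, hc⟩
        · rintro ⟨⟨hf, hD⟩, g, -, -, hc⟩
          exact ⟨hf, hD, hc⟩
      _ ≤ ∑ D ∈ hshadow G 3, (1 : ℝ) := Finset.sum_le_sum fun D _ => sum_share_le_one G t D
      _ = #(hshadow G 3) := by simp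
  rw [mul_div_assoc', div_le_iff₀ (by linarith)] at h1
  linarith

theorem card_le_of_not_hasDoubleStar (ht : 5 ≤ t) (hm : k + m₁ + m₂ + m₃ + m₄ + 2 = t)
    (hk : (t - 1) / 3 ≤ k) (G : Finset (Finset W)) (hG : ∀ g ∈ G, #g = 3)
    (hno : ¬ HasDoubleStar G k m₁ m₂ m₃ m₄) :
    (#G : ℝ) ≤ ((t : ℝ) - 1) / 3 * #(hshadow G 3) := by
  induction hc : #G using Nat.strong_induction_on generalizing G with
  | _ c ih =>
  subst hc
  by_cases hlow : ∃ D ∈ hshadow G 3, 3 * degree G D ≤ t - 1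
  · obtain ⟨D, hD, hdeg⟩ := hlow
    have hsplit := Finset.card_filter_add_card_filter_not (s := G) (fun e => D ⊆ e)
    have hD' := hD
    simp only [hshadow, Finset.mem_biUnion, Finset.mem_powersetCard] at hD'
    obtain ⟨e, he, hDe, -⟩ := hD'
    have hpos : 0 < degree G D := Finset.card_pos.2 ⟨e, Finset.mem_filter.2 ⟨he, hDe⟩⟩
    change degree G D + _ = _ at hsplit
    have hrec := ih _ (by omega) (G.filter fun e => ¬ D ⊆ e)
      (fun g hg => hG g (Finset.mem_of_mem_filter g hg))
      (fun h => hno (h.mono (Finset.filter_subset _ _))) rfl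
    have hsub : hshadow (G.filter fun e => ¬ D ⊆ e) 3 ⊆ (hshadow G 3).erase D := by
      intro E hE
      simp only [hshadow, Finset.mem_biUnion, Finset.mem_powersetCard, Finset.mem_filter,
        Finset.mem_erase] at hE ⊢
      obtain ⟨g, ⟨hg, hDg⟩, hEg, hc⟩ := hE
      exact ⟨by rintro rfl; exact hDg hEg, g, hg, hEg, hc⟩
    have hcard := Finset.card_le_card hsub
    rw [Finset.card_erase_of_mem hD] at hcard
    have hspos : 0 < #(hshadow G 3) := Finset.card_pos.2 ⟨D, hD⟩
    have hcard' : (#(hshadow (G.filter fun e => ¬ D ⊆ e) 3) : ℝ) + 1 ≤ #(hshadow G 3) := by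
      exact_mod_cast (by omega : _ + 1 ≤ #(hshadow G 3))
    have hdeg' : 3 * (degree G D : ℝ) + 1 ≤ t := by
      exact_mod_cast (by omega : 3 * degree G D + 1 ≤ t)
    have hsplit' : (degree G D : ℝ) + #(G.filter fun e => ¬ D ⊆ e) = #G := by
      exact_mod_cast hsplit
    have ht' : (5 : ℝ) ≤ t := by exact_mod_cast ht
    have := mul_le_mul_of_nonneg_left hcard' (by linarith : 0 ≤ ((t : ℝ) - 1) / 3)
    linarith
  · push Not at hlow
    refine card_le_of_min_degree hG ht (fun P Q R h => ?_) hm hk hno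
    obtain ⟨hPQ, -, -⟩ := ne_of_mem hG h
    rw [← degree_eq_card_nbr hG (Finset.card_pair hPQ)]
    have := hlow {P, Q} (by
      simp only [hshadow, Finset.mem_biUnion, Finset.mem_powersetCard]
      exact ⟨_, h, by intro z; simp; tauto, Finset.card_pair hPQ⟩)
    omega

end Weights

section Tree

variable {V W : Type*} [DecidableEq V] [DecidableEq W]

/-- An embedding of the vertex set `C` extends to pendant edges with distinct new vertices. -/
lemma containsCopy_of_pendant {G : Finset (Finset W)} {T R : Finset (Finset V)} {C : Finset V}
    {f₀ : V → W} (hf₀ : Set.InjOn f₀ C) (hT : ∀ g ∈ T, g ∉ R → g ⊆ C ∧ g.image f₀ ∈ G)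
    {leaf : Finset V → V} (hleaf : ∀ g ∈ R, leaf g ∉ C ∧ leaf g ∈ g ∧ g.erase (leaf g) ⊆ C)
    (hinj : Set.InjOn leaf R) {φ : Finset V → W} (hφ : Set.InjOn φ R)
    (hφC : ∀ g ∈ R, φ g ∉ C.image f₀)
    (hφG : ∀ g ∈ R, insert (φ g) ((g.erase (leaf g)).image f₀) ∈ G) : ContainsCopy G T := by
  classical
  let f : V → W := fun v =>
    if v ∈ C then f₀ v else if h : ∃ g ∈ R, leaf g = v then φ h.choose else f₀ v
  have hfC : ∀ v ∈ C, f v = f₀ v := fun v hv => by simp [f, hv]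
  have hfl : ∀ g ∈ R, f (leaf g) = φ g := by
    intro g hg
    have h : ∃ g' ∈ R, leaf g' = leaf g := ⟨g, hg, rfl⟩
    simp only [f, (hleaf g hg).1, if_false, dif_pos h]
    rw [hinj h.choose_spec.1 hg h.choose_spec.2]
  have hcases : ∀ v ∈ T.biUnion id, v ∈ C ∨ ∃ g ∈ R, v = leaf g := by
    intro v hv
    obtain ⟨g, hg, hvg⟩ := Finset.mem_biUnion.1 hv
    by_cases hgR : g ∈ R
    · by_cases hvl : v = leaf g
      · exact Or.inr ⟨g, hgR, hvl⟩
      · exact Or.inl ((hleaf g hgR).2.2 (Finset.mem_erase.2 ⟨hvl, hvg⟩))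
    · exact Or.inl ((hT g hg hgR).1 hvg)
  refine ⟨f, ?_, ?_⟩
  · intro u hu v hv huv
    rcases hcases u hu with hu | ⟨g, hg, rfl⟩ <;> rcases hcases v hv with hv | ⟨g', hg', rfl⟩
    · rw [hfC u hu, hfC v hv] at huv
      exact hf₀ hu hv huv
    · rw [hfC u hu, hfl g' hg'] at huv
      exact absurd (Finset.mem_image.2 ⟨u, hu, huv⟩) (hφC g' hg')
    · rw [hfC v hv, hfl g hg] at huv
      exact absurd (Finset.mem_image.2 ⟨v, hv, huv.symm⟩) (hφC g hg)
    · rw [hfl g hg, hfl g' hg'] at huv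
      rw [hφ hg hg' huv]
  · intro g hg
    by_cases hgR : g ∈ R
    · obtain ⟨-, hl, hC⟩ := hleaf g hgR
      rw [← Finset.insert_erase hl, Finset.image_insert, hfl g hgR,
        Finset.image_congr (g := f₀) fun v hv => hfC v (hC hv)]
      exact hφG g hgR
    · obtain ⟨hC, hG⟩ := hT g hg hgR
      rwa [Finset.image_congr (g := f₀) fun v hv => hfC v (hC hv)]

/-- Distinct representatives for a family whose members are grouped into classes with pairwise
disjoint target sets. -/
lemma exists_injOn_of_classes {α β γ : Type*} [DecidableEq β] [Nonempty γ] {R : Finset α}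
    {base : α → β} {P : Finset β} (hbase : ∀ g ∈ R, base g ∈ P) {L : β → Finset γ}
    (hdis : Set.PairwiseDisjoint (P : Set β) L)
    (hcard : ∀ c ∈ P, #(R.filter fun g => base g = c) ≤ #(L c)) :
    ∃ φ : α → γ, Set.InjOn φ R ∧ ∀ g ∈ R, φ g ∈ L (base g) := by
  classical
  have h : ∀ c ∈ P, ∃ φ : α → γ, Set.InjOn φ (R.filter fun g => base g = c) ∧
      ∀ g ∈ R.filter (fun g => base g = c), φ g ∈ L c := by
    intro c hc
    obtain ⟨e⟩ := Function.Embedding.nonempty_of_card_le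
      (α := {g // g ∈ R.filter fun g => base g = c}) (β := {w // w ∈ L c})
      (by simpa only [Fintype.card_coe] using hcard c hc)
    refine ⟨fun g => if h : g ∈ R.filter (fun g => base g = c) then (e ⟨g, h⟩).1
      else Classical.arbitrary γ, ?_, ?_⟩
    · intro g hg g' hg' hgg'
      simp only [Finset.mem_coe] at hg hg'
      simp only [dif_pos hg, dif_pos hg'] at hgg'
      exact congrArg Subtype.val (e.injective (Subtype.ext hgg'))
    · intro g hg
      simp only [dif_pos hg]
      exact (e ⟨g, hg⟩).2
  choose! φ hφ hφL using h
  have hmem : ∀ g ∈ R, φ (base g) g ∈ L (base g) := fun g hg =>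
    hφL _ (hbase g hg) g (Finset.mem_filter.2 ⟨hg, rfl⟩)
  refine ⟨fun g => φ (base g) g, ?_, hmem⟩
  intro g hg g' hg' hgg'
  have hgg : φ (base g) g = φ (base g') g' := hgg'
  by_cases hb : base g = base g'
  · refine hφ (base g) (hbase g hg) ?_ ?_ (by rw [hgg, hb])
    · simpa using hg
    · simpa using ⟨hg', hb.symm⟩
  · exact absurd (hgg ▸ hmem g' hg')
      (Finset.disjoint_left.1 (hdis (hbase g hg) (hbase g' hg') hb) (hmem g hg))

/-- The shape of a tight 3-tree with a trunk of two edges. -/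
lemma exists_structure_of_isTrunk {T : Finset (Finset V)} {e₁ e₂ : Finset V} (h12 : e₁ ≠ e₂)
    (h : IsTrunk 3 T {e₁, e₂}) :
    ∃ (x y a b : V) (leaf : Finset V → V), x ≠ y ∧ x ≠ a ∧ y ≠ a ∧ x ≠ b ∧ y ≠ b ∧ a ≠ b ∧
      e₁ = {x, y, a} ∧ e₂ = {x, y, b} ∧ e₁ ∈ T ∧ e₂ ∈ T ∧
      Set.InjOn leaf ↑(T \ {e₁, e₂}) ∧ ∀ g ∈ T \ {e₁, e₂},
        leaf g ∉ ({x, y, a, b} : Finset V) ∧ leaf g ∈ g ∧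
        g.erase (leaf g) ∈
          ({{x, y}, {x, a}, {y, a}, {x, b}, {y, b}} : Finset (Finset V)) := by
  obtain ⟨e, t, t', htt, ⟨rfl, hcard, hord⟩, himg, hlf⟩ := h
  have hinj : ∀ i < t, ∀ j < i, e i ≠ e j := by
    intro i hi j hj hij
    obtain ⟨v, hv, hnew, -⟩ := hord i (by omega) hi
    exact hnew j hj (hij ▸ hv)
  have ht' : t' = 2 := by
    have h1 : #((Finset.range t').image e) = t' := by
      rw [Finset.card_image_of_injOn, Finset.card_range]
      intro i hi j hj hij
      simp only [Finset.coe_range, Set.mem_Iio] at hi hj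
      rcases lt_trichotomy i j with h | h | h
      · exact absurd hij.symm (hinj j (by omega) i h)
      · exact h
      · exact absurd hij (hinj i (by omega) j h)
    rw [← h1, ← himg, Finset.card_pair h12]
  subst ht'
  have h01 : ({e₁, e₂} : Finset (Finset V)) = {e 0, e 1} := by
    rw [himg]
    ext g
    simp [Finset.range_add_one, or_comm]
  have hunion : ∀ v, v ∈ ({e₁, e₂} : Finset (Finset V)).biUnion id ↔ v ∈ e₁ ∪ e₂ := by
    intro v
    simp
  have hunion' : e₁ ∪ e₂ = e 0 ∪ e 1 := by
    have := congrArg (fun S : Finset (Finset V) => S.biUnion id) h01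
    simpa using this
  have hmem : e₁ = e 0 ∧ e₂ = e 1 ∨ e₁ = e 1 ∧ e₂ = e 0 := by
    have m1 : e₁ ∈ ({e 0, e 1} : Finset (Finset V)) := h01 ▸ by simp
    have m2 : e₂ ∈ ({e 0, e 1} : Finset (Finset V)) := h01 ▸ by simp
    simp only [Finset.mem_insert, Finset.mem_singleton] at m1 m2
    rcases m1 with m1 | m1 <;> rcases m2 with m2 | m2
    · exact absurd (m1.trans m2.symm) h12
    · exact Or.inl ⟨m1, m2⟩
    · exact Or.inr ⟨m1, m2⟩
    · exact absurd (m1.trans m2.symm) h12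
  have hleaf_unique : ∀ v, v ∉ e₁ ∪ e₂ → ∀ i < t, ∀ j < t, v ∈ e i → v ∈ e j → e i = e j := by
    intro v hv i hi j hj hvi hvj
    have hmi : e i ∈ (Finset.range t).image e := Finset.mem_image_of_mem e (Finset.mem_range.2 hi)
    have hmj : e j ∈ (Finset.range t).image e := Finset.mem_image_of_mem e (Finset.mem_range.2 hj)
    have h1 := hlf v (Finset.mem_biUnion.2 ⟨e i, hmi, hvi⟩) (by rwa [hunion])
    exact Finset.card_le_one.1 (le_of_eq h1) _ (Finset.mem_filter.2 ⟨hmi, hvi⟩) _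
      (Finset.mem_filter.2 ⟨hmj, hvj⟩)
  -- every later edge hangs on a pair of one of the two trunk edges
  have hpend : ∀ i, 2 ≤ i → i < t → ∃ v ∈ e i, v ∉ e₁ ∪ e₂ ∧
      ((e i).erase v ⊆ e₁ ∨ (e i).erase v ⊆ e₂) := by
    intro i
    induction i using Nat.strong_induction_on with
    | _ i ih =>
    intro h2 hi
    obtain ⟨v, hv, hnew, j, hj, hsub⟩ := hord i (by omega) hi
    have hvn : v ∉ e₁ ∪ e₂ := by
      rw [hunion', Finset.mem_union, not_or]
      exact ⟨hnew 0 (by omega), hnew 1 (by omega)⟩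
    refine ⟨v, hv, hvn, ?_⟩
    by_cases hj2 : 2 ≤ j
    · obtain ⟨w, hw, hwn, hwsub⟩ := ih j hj hj2 (by omega)
      have hwi : w ∉ e i := fun hwi =>
        hinj i hi j hj (hleaf_unique w hwn i hi j (by omega) hwi hw)
      have hsub' : (e i).erase v ⊆ (e j).erase w := fun z hz => Finset.mem_erase.2
        ⟨by rintro rfl; exact hwi (Finset.mem_of_mem_erase hz), hsub hz⟩
      exact hwsub.imp hsub'.trans hsub'.trans
    · have : j = 0 ∨ j = 1 := by omega
      rcases hmem with ⟨rfl, rfl⟩ | ⟨rfl, rfl⟩ <;> rcases this with rfl | rfl <;> tauto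
  have hT : ∀ i < t, e i ∈ (Finset.range t).image e := fun i hi =>
    Finset.mem_image_of_mem e (Finset.mem_range.2 hi)
  obtain ⟨v, hv, hnew, j, hj, hsub⟩ := hord 1 (by omega) (by omega)
  obtain rfl : j = 0 := by omega
  have hc1 := hcard 1 (by omega)
  have hc0 := hcard 0 (by omega)
  have hce : #((e 1).erase v) = 2 := by rw [Finset.card_erase_of_mem hv, hc1]
  obtain ⟨x, y, hxy, hxye⟩ := Finset.card_eq_two.1 hce
  have he1 : e 1 = {x, y, v} := by
    rw [← Finset.insert_erase hv, hxye]
    ext z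
    simp
    tauto
  have he0 : ∃ u, e 0 = {x, y, u} := by
    rw [hxye] at hsub
    have h1 : #(e 0 \ {x, y}) = 1 := by
      rw [Finset.card_sdiff_of_subset hsub, hc0, Finset.card_pair hxy]
    obtain ⟨u, hu⟩ := Finset.card_eq_one.1 h1
    refine ⟨u, ?_⟩
    rw [← Finset.sdiff_union_of_subset hsub, hu]
    ext z
    simp
    tauto
  obtain ⟨u, he0⟩ := he0
  obtain ⟨a, b, ha, hb⟩ : ∃ a b, e₁ = {x, y, a} ∧ e₂ = {x, y, b} := by
    rcases hmem with ⟨h1, h2⟩ | ⟨h1, h2⟩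
    · exact ⟨u, v, h1.trans he0, h2.trans he1⟩
    · exact ⟨v, u, h1.trans he1, h2.trans he0⟩
  have hcc : #e₁ = 3 ∧ #e₂ = 3 := by
    rcases hmem with ⟨h1, h2⟩ | ⟨h1, h2⟩ <;> rw [h1, h2] <;> exact ⟨by assumption, by assumption⟩
  have hCeq : e₁ ∪ e₂ = {x, y, a, b} := by
    rw [ha, hb]
    ext z
    simp only [Finset.mem_union, Finset.mem_insert, Finset.mem_singleton]
    tauto
  have hG : ∀ g ∈ ({e₁, e₂} : Finset (Finset V)), #g = 3 := by
    simp only [Finset.mem_insert, Finset.mem_singleton]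
    rintro g (rfl | rfl)
    exacts [hcc.1, hcc.2]
  obtain ⟨-, hxa, hya⟩ := ne_of_mem hG (X := x) (Y := y) (A := a) (by simp [ha])
  obtain ⟨-, hxb, hyb⟩ := ne_of_mem hG (X := x) (Y := y) (A := b) (by simp [hb])
  have hrest : ∀ g ∈ (Finset.range t).image e \ {e₁, e₂}, ∃ i, 2 ≤ i ∧ i < t ∧ e i = g := by
    intro g hg
    rw [h01] at hg
    simp only [Finset.mem_sdiff, Finset.mem_image, Finset.mem_range, Finset.mem_insert,
      Finset.mem_singleton, not_or] at hg
    obtain ⟨⟨i, hi, rfl⟩, h0, h1⟩ := hg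
    refine ⟨i, ?_, hi, rfl⟩
    by_contra hlt
    have : i = 0 ∨ i = 1 := by omega
    rcases this with rfl | rfl
    exacts [h0 rfl, h1 rfl]
  have hexl : ∀ g ∈ (Finset.range t).image e \ {e₁, e₂}, ∃ w ∈ g, w ∉ e₁ ∪ e₂ ∧
      (g.erase w ⊆ e₁ ∨ g.erase w ⊆ e₂) := by
    intro g hg
    obtain ⟨i, h2, hi, rfl⟩ := hrest g hg
    exact hpend i h2 hi
  have : Nonempty V := ⟨x⟩
  choose! leaf hl1 hl2 hl3 using hexl
  refine ⟨x, y, a, b, leaf, hxy, hxa, hya, hxb, hyb, fun hab => h12 (by rw [ha, hb, hab]), ha, hb,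
    ?_, ?_, ?_, ?_⟩
  · rcases hmem with ⟨h1, h2⟩ | ⟨h1, h2⟩ <;> rw [h1] <;> exact hT _ (by omega)
  · rcases hmem with ⟨h1, h2⟩ | ⟨h1, h2⟩ <;> rw [h2] <;> exact hT _ (by omega)
  · intro g hg g' hg' hgg'
    obtain ⟨i, h2, hi, rfl⟩ := hrest g hg
    obtain ⟨j, h2', hj, rfl⟩ := hrest g' hg'
    exact hleaf_unique _ (hl2 _ hg) i hi j hj (hl1 _ hg) (hgg' ▸ hl1 _ hg')
  · intro g hg
    refine ⟨hCeq ▸ hl2 g hg, hl1 g hg, ?_⟩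
    have hg2 : #(g.erase (leaf g)) = 2 := by
      obtain ⟨i, -, hi, rfl⟩ := hrest g hg
      rw [Finset.card_erase_of_mem (hl1 _ hg), hcard i hi]
    rcases hl3 g hg with h | h
    · have := Finset.mem_powersetCard.2 ⟨h, hg2⟩
      rw [ha, powersetCard_two_triple hxy hxa hya] at this
      simp only [Finset.mem_insert, Finset.mem_singleton] at this ⊢
      tauto
    · have := Finset.mem_powersetCard.2 ⟨h, hg2⟩
      rw [hb, powersetCard_two_triple hxy hxb hyb] at this
      simp only [Finset.mem_insert, Finset.mem_singleton] at this ⊢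
      tauto

end Tree

section Main

variable {V W : Type*} [DecidableEq V] [Fintype W] [DecidableEq W]

/-- A double star whose pendant counts are those of `T` yields a copy of `T`. -/
lemma containsCopy_of_hasDoubleStar {G : Finset (Finset W)} (hG : ∀ g ∈ G, #g = 3)
    {T R : Finset (Finset V)} {x y a b : V} {leaf : Finset V → V} (hxy : x ≠ y) (hxa : x ≠ a)
    (hya : y ≠ a) (hxb : x ≠ b) (hyb : y ≠ b) (hab : a ≠ b)
    (hR : R = T \ {{x, y, a}, {x, y, b}}) (hinj : Set.InjOn leaf R)
    (hleaf : ∀ g ∈ R,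
      leaf g ∉ ({x, y, a, b} : Finset V) ∧ leaf g ∈ g ∧
        g.erase (leaf g) ∈ ({{x, y}, {x, a}, {y, a}, {x, b}, {y, b}} : Finset (Finset V)))
    {m : Finset V → ℕ}
    (hm : ∀ c, #(R.filter fun g => g.erase (leaf g) = c) = m c)
    (h : HasDoubleStar G (m {x, y}) (m {x, a}) (m {y, a}) (m {x, b}) (m {y, b})) :
    ContainsCopy G T := by
  obtain ⟨X, Y, A, B, hAB, hA, hB, K, L₁, L₂, L₃, L₄, hK, hkc, ⟨h1, h2, h3, h4⟩,
    ⟨c1, c2, c3, c4⟩, ⟨d12, d13, d14, d23, d24, d34⟩, dK1, dK2, dK3, dK4⟩ := h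
  obtain ⟨hXY, hXA, hYA⟩ := ne_of_mem hG hA
  obtain ⟨-, hXB, hYB⟩ := ne_of_mem hG hB
  obtain ⟨f₀, fx, fy, fa, fb⟩ : ∃ f₀ : V → W, f₀ x = X ∧ f₀ y = Y ∧ f₀ a = A ∧ f₀ b = B :=
    ⟨fun v => if v = x then X else if v = y then Y else if v = a then A else B, by simp,
      by simp [hxy.symm], by simp [hxa.symm, hya.symm], by simp [hxb.symm, hyb.symm, hab.symm]⟩
  have p1 : ({x, a} : Finset V) ≠ {x, y} := pair_ne_pair hxa hya x
  have p2 : ({y, a} : Finset V) ≠ {x, y} := pair_ne_pair hxa hya y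
  have p3 : ({x, b} : Finset V) ≠ {x, y} := pair_ne_pair hxb hyb x
  have p4 : ({y, b} : Finset V) ≠ {x, y} := pair_ne_pair hxb hyb y
  have p12 : ({y, a} : Finset V) ≠ {x, a} := fun h => by
    have : y ∈ ({x, a} : Finset V) := h ▸ by simp
    simp [hxy.symm, hya] at this
  have p13 : ({x, b} : Finset V) ≠ {x, a} := pair_ne_pair hxb hab x
  have p14 : ({y, b} : Finset V) ≠ {x, a} := pair_ne_pair hxb hab y
  have p23 : ({x, b} : Finset V) ≠ {y, a} := pair_ne_pair hyb hab x
  have p24 : ({y, b} : Finset V) ≠ {y, a} := pair_ne_pair hyb hab y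
  have p34 : ({y, b} : Finset V) ≠ {x, b} := fun h => by
    have : y ∈ ({x, b} : Finset V) := h ▸ by simp
    simp [hxy.symm, hyb] at this
  obtain ⟨L, l0, l1, l2, l3, l4⟩ : ∃ L : Finset V → Finset W,
      L {x, y} = K ∧ L {x, a} = L₁ ∧ L {y, a} = L₂ ∧ L {x, b} = L₃ ∧ L {y, b} = L₄ :=
    ⟨fun c => if c = {x, y} then K else if c = {x, a} then L₁ else
      if c = {y, a} then L₂ else if c = {x, b} then L₃ else L₄, if_pos rfl,
      by simp only [if_neg p1, if_pos],
      by simp only [if_neg p2, if_neg p12, if_pos],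
      by simp only [if_neg p3, if_neg p13, if_neg p23, if_pos],
      by simp only [if_neg p4, if_neg p14, if_neg p24, if_neg p34]⟩
  have : Nonempty W := ⟨X⟩
  have hdis : Set.PairwiseDisjoint
      (({{x, y}, {x, a}, {y, a}, {x, b}, {y, b}} : Finset (Finset V)) : Set (Finset V)) L := by
    intro c hc d hd hcd
    simp only [Finset.coe_insert, Finset.coe_singleton, Set.mem_insert_iff,
      Set.mem_singleton_iff] at hc hd
    rcases hc with rfl | rfl | rfl | rfl | rfl <;> rcases hd with rfl | rfl | rfl | rfl | rfl <;>
      first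
      | simp only [Function.onFun, l0, l1, l2, l3, l4, d12, d13, d14, d23, d24, d34, d12.symm,
          d13.symm, d14.symm, d23.symm, d24.symm, d34.symm, dK1, dK2, dK3, dK4, dK1.symm,
          dK2.symm, dK3.symm, dK4.symm]
        done
      | exact (hcd rfl).elim
  have hcard : ∀ c ∈ ({{x, y}, {x, a}, {y, a}, {x, b}, {y, b}} : Finset (Finset V)),
      #(R.filter fun g => g.erase (leaf g) = c) ≤ #(L c) := by
    intro c hc
    rw [hm]
    simp only [Finset.mem_insert, Finset.mem_singleton] at hc
    rcases hc with rfl | rfl | rfl | rfl | rfl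
    · rw [l0, hkc]
    · rw [l1, c1]
    · rw [l2, c2]
    · rw [l3, c3]
    · rw [l4, c4]
  obtain ⟨φ, hφ, hφL⟩ := exists_injOn_of_classes (base := fun g : Finset V => g.erase (leaf g))
    (fun g hg => (hleaf g hg).2.2) hdis hcard
  have hnbr : ∀ {P Q P' Q' w : W}, w ∈ nbr G {P, Q} \ {P', Q'} →
      ((w ≠ P ∧ w ≠ Q) ∧ {w, P, Q} ∈ G) ∧ w ≠ P' ∧ w ≠ Q' := fun h => by
    simpa only [nbr, Finset.mem_sdiff, Finset.mem_filter, Finset.mem_univ, true_and,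
      Finset.mem_insert, Finset.mem_singleton, not_or] using h
  have key : ∀ c ∈ ({{x, y}, {x, a}, {y, a}, {x, b}, {y, b}} : Finset (Finset V)),
      ∀ w ∈ L c, w ∉ ({X, Y, A, B} : Finset W) ∧ insert w (c.image f₀) ∈ G := by
    intro c hc w hw
    simp only [Finset.mem_insert, Finset.mem_singleton] at hc
    rcases hc with rfl | rfl | rfl | rfl | rfl <;>
      simp only [l0, l1, l2, l3, l4, Finset.image_insert, Finset.image_singleton, fx, fy, fa, fb,
        Finset.mem_insert, Finset.mem_singleton, not_or] at hw ⊢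
    · obtain ⟨⟨⟨hX, hY⟩, hg⟩, hA', hB'⟩ := hnbr (hK hw)
      exact ⟨⟨hX, hY, hA', hB'⟩, hg⟩
    · obtain ⟨⟨⟨hX, hA'⟩, hg⟩, hY, hB'⟩ := hnbr (h1 hw)
      exact ⟨⟨hX, hY, hA', hB'⟩, hg⟩
    · obtain ⟨⟨⟨hY, hA'⟩, hg⟩, hX, hB'⟩ := hnbr (h2 hw)
      exact ⟨⟨hX, hY, hA', hB'⟩, hg⟩
    · obtain ⟨⟨⟨hX, hB'⟩, hg⟩, hY, hA'⟩ := hnbr (h3 hw)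
      exact ⟨⟨hX, hY, hA', hB'⟩, hg⟩
    · obtain ⟨⟨⟨hY, hB'⟩, hg⟩, hX, hA'⟩ := hnbr (h4 hw)
      exact ⟨⟨hX, hY, hA', hB'⟩, hg⟩
  have himg : ({x, y, a, b} : Finset V).image f₀ = {X, Y, A, B} := by
    simp only [Finset.image_insert, Finset.image_singleton, fx, fy, fa, fb]
  refine containsCopy_of_pendant (R := R) (C := {x, y, a, b}) (f₀ := f₀)
    ?_ ?_ (leaf := leaf) ?_ hinj hφ ?_ ?_
  · intro u hu v hv huv
    simp only [Finset.coe_insert, Finset.coe_singleton, Set.mem_insert_iff,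
      Set.mem_singleton_iff] at hu hv
    rcases hu with rfl | rfl | rfl | rfl <;> rcases hv with rfl | rfl | rfl | rfl <;>
      simp only [fx, fy, fa, fb] at huv <;>
      first
      | rfl
      | exact absurd huv (by assumption)
      | exact absurd huv.symm (by assumption)
  · intro g hg hgR
    have : g = {x, y, a} ∨ g = {x, y, b} := by
      rw [hR, Finset.mem_sdiff, not_and, not_not] at hgR
      simpa using hgR hg
    rcases this with rfl | rfl
    · refine ⟨by simp [Finset.insert_subset_iff], ?_⟩
      · simpa only [Finset.image_insert, Finset.image_singleton, fx, fy, fa] using hA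
    · refine ⟨by simp [Finset.insert_subset_iff], ?_⟩
      · simpa only [Finset.image_insert, Finset.image_singleton, fx, fy, fb] using hB
  · intro g hg
    obtain ⟨hl, hlg, hc⟩ := hleaf g hg
    refine ⟨hl, hlg, ?_⟩
    simp only [Finset.mem_insert, Finset.mem_singleton] at hc
    rcases hc with hc | hc | hc | hc | hc <;> rw [hc] <;> simp [Finset.insert_subset_iff]
  · intro g hg
    rw [himg]
    exact (key _ (hleaf g hg).2.2 _ (hφL g hg)).1
  · intro g hg
    exact (key _ (hleaf g hg).2.2 _ (hφL g hg)).2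

end Main

/-- Lemma 3.3, a special case of the main theorem. -/
theorem stmt9 {V : Type*} {W : Type*} [DecidableEq V] [Fintype W] [DecidableEq W]
    (t : ℕ) (ht : 5 ≤ t)
    (T : Finset (Finset V)) (hTt : T.card = t)
    (hT : IsTightTree 3 T)
    (e1 e2 : Finset V) (h12 : e1 ≠ e2)
    (htrunk : IsTrunk 3 T {e1, e2})
    (hdeg : (t - 1) / 3 + 2 ≤ degree T (e1 ∩ e2))
    (n : ℕ) (hn : Fintype.card W = n)
    (G : Finset (Finset W)) (hG : ∀ g ∈ G, g.card = 3)
    (hfree : ¬ ContainsCopy G T) :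
    (G.card : ℝ) ≤ ((t : ℝ) - 1) / 3 * ((hshadow G 3).card : ℝ) := by
  obtain ⟨x, y, a, b, leaf, hxy, hxa, hya, hxb, hyb, hab, rfl, rfl, he1, he2, hinj, hleaf⟩ :=
    exists_structure_of_isTrunk h12 htrunk
  set R := T \ {{x, y, a}, {x, y, b}} with hR
  let m : Finset V → ℕ := fun c => #(R.filter fun g => g.erase (leaf g) = c)
  have hRc : #R + 2 = t := by
    have hsub : ({{x, y, a}, {x, y, b}} : Finset (Finset V)) ⊆ T := by
      simp [Finset.insert_subset_iff, he1, he2]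
    have := Finset.card_sdiff_add_card_eq_card hsub
    rw [Finset.card_pair h12, ← hR] at this
    omega
  have hsum : m {x, y} + m {x, a} + m {y, a} + m {x, b} + m {y, b} = #R := by
    rw [Finset.card_eq_sum_card_fiberwise fun g hg => (hleaf g hg).2.2]
    have p12 : ({x, a} : Finset V) ≠ {y, a} := fun h => by
      have : x ∈ ({y, a} : Finset V) := h ▸ by simp
      simp [hxy, hxa] at this
    have p34 : ({x, b} : Finset V) ≠ {y, b} := fun h => by
      have : x ∈ ({y, b} : Finset V) := h ▸ by simp
      simp [hxy, hxb] at this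
    rw [Finset.sum_insert, Finset.sum_insert, Finset.sum_insert, Finset.sum_insert,
      Finset.sum_singleton]
    · simp only [m]
      omega
    · simpa using p34
    · simpa using ⟨(pair_ne_pair hyb hab x).symm, (pair_ne_pair hyb hab y).symm⟩
    · simpa using ⟨p12, (pair_ne_pair hxb hab x).symm, (pair_ne_pair hxb hab y).symm⟩
    · simpa using ⟨(pair_ne_pair hxa hya x).symm, (pair_ne_pair hxa hya y).symm,
        (pair_ne_pair hxb hyb x).symm, (pair_ne_pair hxb hyb y).symm⟩
  have hinter : ({x, y, a} ∩ {x, y, b} : Finset V) = {x, y} := by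
    ext z
    simp only [Finset.mem_inter, Finset.mem_insert, Finset.mem_singleton]
    constructor
    · rintro ⟨rfl | rfl | rfl, h⟩
      · exact Or.inl rfl
      · exact Or.inr rfl
      · rcases h with h | h | h
        exacts [Or.inl h, Or.inr h, absurd h hab]
    · tauto
  have hk : (t - 1) / 3 ≤ m {x, y} := by
    rw [hinter] at hdeg
    have hsub : (T.filter fun g => {x, y} ⊆ g) ⊆
        {{x, y, a}, {x, y, b}} ∪ R.filter fun g => g.erase (leaf g) = {x, y} := by
      intro g hg
      obtain ⟨hgT, hxyg⟩ := Finset.mem_filter.1 hg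
      by_cases hgR : g ∈ R
      · obtain ⟨hl, -, hc⟩ := hleaf g hgR
        have hsub : {x, y} ⊆ g.erase (leaf g) := fun z hz => Finset.mem_erase.2
          ⟨by rintro rfl; exact hl (by
            simp only [Finset.mem_insert, Finset.mem_singleton] at hz ⊢
            tauto), hxyg hz⟩
        have hc2 : #(g.erase (leaf g)) ≤ 2 := by
          simp only [Finset.mem_insert, Finset.mem_singleton] at hc
          rcases hc with hc | hc | hc | hc | hc <;> rw [hc] <;> exact Finset.card_le_two
        exact Finset.mem_union_right _ (Finset.mem_filter.2 ⟨hgR,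
          (Finset.eq_of_subset_of_card_le hsub (by rwa [Finset.card_pair hxy])).symm⟩)
      · rw [hR, Finset.mem_sdiff, not_and, not_not] at hgR
        exact Finset.mem_union_left _ (hgR hgT)
    have h1 := (Finset.card_le_card hsub).trans (Finset.card_union_le _ _)
    rw [Finset.card_pair h12] at h1
    simp only [degree] at hdeg
    simp only [m]
    omega
  exact card_le_of_not_hasDoubleStar ht (by omega) hk G hG fun hds =>
    hfree (containsCopy_of_hasDoubleStar hG hxy hxa hya hxb hyb hab hR hinj hleaf (m := m)
      (fun _ => rfl) hds)
end

section
/- Let m > 0 be a real number, let G be a 3-graph, and let e = abc be an edge of G with d_G(ab) ≤ d_G(bc) ≤ d_G(ac) and w(e) = 1/d_G(ab) + 1/d_G(bc) + 1/d_G(ac) < 3/m. If d_G(ab) = ⌊m/3⌋ + 1, then d_G(ac) ≥ d_G(bc) > m(m+3)/9. -/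
open Finset

variable {V : Type*}

/-- refined degree bounds for a light edge whose low side has smallest
possible degree. -/
theorem stmt12 {V : Type*} [DecidableEq V] (m : ℝ) (hm : 0 < m)
    (G : Finset (Finset V)) (hG : ∀ g ∈ G, g.card = 3)
    (a b c : V) (hab : a ≠ b) (hac : a ≠ c) (hbc : b ≠ c)
    (he : ({a, b, c} : Finset V) ∈ G)
    (h1 : degree G {a, b} ≤ degree G {b, c})
    (h2 : degree G {b, c} ≤ degree G {a, c})
    (hw : (1 : ℝ) / (degree G {a, b} : ℝ) + 1 / (degree G {b, c} : ℝ)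
        + 1 / (degree G {a, c} : ℝ) < 3 / m)
    (hd : degree G {a, b} = ⌊m / 3⌋₊ + 1) :
    degree G {b, c} ≤ degree G {a, c} ∧ m * (m + 3) / 9 < (degree G {b, c} : ℝ) := by
  refine ⟨h2, ?_⟩
  have hp : (degree G {a, b} : ℝ) ≤ (m + 3) / 3 := by
    rw [hd]
    push_cast
    linarith [Nat.floor_le (show 0 ≤ m / 3 by positivity)]
  have hp0 : (0 : ℝ) < degree G {a, b} := by
    rw [hd]
    positivity
  have hq0 : (0 : ℝ) < degree G {b, c} := hp0.trans_le (by exact_mod_cast h1)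
  have hr0 : (0 : ℝ) ≤ 1 / (degree G {a, c} : ℝ) := by positivity
  have hp' : 1 / ((m + 3) / 3) ≤ 1 / (degree G {a, b} : ℝ) :=
    one_div_le_one_div_of_le hp0 hp
  have hgap : 3 / m - 1 / ((m + 3) / 3) = 1 / (m * (m + 3) / 9) := by
    field_simp
    ring
  exact lt_of_one_div_lt_one_div hq0 (by linarith)
end

section
/- Let T be a tight 3-tree with t edges having a trunk {e₁, e₂} of size 2, where e₁ = xyu, e₂ = xyv and e₁ ∩ e₂ = {x,y}. For each pair B contained in e₁ or e₂, let μ(B) = |N_T(B) ∖ {x,y,u,v}|. Then μ(xy) = d_T(xy) − 2, μ(B) = d_T(B) − 1 for each B ∈ {xu, xv, yu, yv}, and μ(xy) + μ(xu) + μ(xv) + μ(yu) + μ(yv) = t − 2. -/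
open Finset

variable {V : Type*}

/-- For a pair `B ⊆ S` in a 3-graph, the neighbours of `B` outside `S` correspond to the edges
containing `B` that are not contained in `S`. -/
theorem card_nbr_sdiff {V : Type*} [Fintype V] [DecidableEq V] {T : Finset (Finset V)}
    (hcard : ∀ g ∈ T, g.card = 3) {B S : Finset V} (hB : B.card = 2) (hBS : B ⊆ S) :
    (nbr T B \ S).card = (T.filter fun g => B ⊆ g ∧ ¬ g ⊆ S).card := by
  refine Finset.card_bij (fun z _ => insert z B) ?_ ?_ ?_
  · intro z hz
    simp only [nbr, Finset.mem_sdiff, Finset.mem_filter, Finset.mem_univ, true_and] at hz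
    simp only [Finset.mem_filter]
    exact ⟨hz.1.2, Finset.subset_insert _ _, fun h => hz.2 (h (Finset.mem_insert_self _ _))⟩
  · intro z hz w hw h
    simp only [nbr, Finset.mem_sdiff, Finset.mem_filter, Finset.mem_univ, true_and] at hz hw
    have hzw : z ∈ insert w B := h ▸ Finset.mem_insert_self z B
    exact (Finset.mem_insert.1 hzw).resolve_right hz.1.1
  · intro g hg
    simp only [Finset.mem_filter] at hg
    obtain ⟨hgT, hBg, hgS⟩ := hg
    obtain ⟨z, hzg, hzS⟩ := Finset.not_subset.1 hgS
    have hzB : z ∉ B := fun h => hzS (hBS h)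
    have heq : insert z B = g := by
      refine Finset.eq_of_subset_of_card_le (Finset.insert_subset hzg hBg) ?_
      rw [hcard g hgT, Finset.card_insert_of_notMem hzB, hB]
    exact ⟨z, by simp [nbr, hzB, hzS, heq, hgT], heq⟩

/-- The degree of a set splits into the edges inside and outside of `S`. -/
theorem degree_eq_card_add_card {V : Type*} [DecidableEq V] (T : Finset (Finset V))
    (B S : Finset V) :
    degree T B = (T.filter fun g => B ⊆ g ∧ ¬ g ⊆ S).card
      + ((T.filter fun g => g ⊆ S).filter fun g => B ⊆ g).card := by
  rw [degree, ← Finset.card_filter_add_card_filter_not (s := T.filter fun g => B ⊆ g)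
    (fun g => g ⊆ S), Finset.filter_filter, Finset.filter_filter, Finset.filter_filter, add_comm]
  simp only [and_comm]

/-- In a proper ordering the edges are pairwise distinct. -/
theorem IsTightTreeOrdering.injOn {V : Type*} [DecidableEq V] {r : ℕ} {T : Finset (Finset V)}
    {e : ℕ → Finset V} {t : ℕ} (h : IsTightTreeOrdering r T e t) :
    Set.InjOn e (Finset.range t) := by
  have aux : ∀ i j, i < j → j < t → e i ≠ e j := by
    intro i j hij hj heq
    obtain ⟨w, hw, hnew, -⟩ := h.2.2 j (by omega) hj
    exact hnew i hij (heq ▸ hw)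
  intro i hi j hj hij
  simp only [Finset.coe_range, Set.mem_Iio] at hi hj
  rcases lt_trichotomy i j with hlt | heq | hlt
  · exact absurd hij (aux i j hlt hj)
  · exact heq
  · exact absurd hij.symm (aux j i hlt hi)

/-- Every edge outside a nonempty trunk arises by adding a leaf to a subset of a trunk edge. -/
theorem IsTrunk.exists_erase_subset {V : Type*} [DecidableEq V] {r : ℕ}
    {T T' : Finset (Finset V)} (h : IsTrunk r T T') (hne : T'.Nonempty) :
    T' ⊆ T ∧ (∀ g ∈ T, g.card = r) ∧
      ∀ g ∈ T, g ∉ T' → ∃ w ∈ g, w ∉ T'.biUnion id ∧ ∃ f ∈ T', g.erase w ⊆ f := by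
  obtain ⟨e, t, t', htt, hord, hT', hleaf⟩ := h
  have hinj := hord.injOn
  obtain ⟨hT, hcard, hstep⟩ := hord
  have hmem : ∀ i < t, e i ∈ T := fun i hi => by
    rw [hT]; exact Finset.mem_image_of_mem _ (Finset.mem_range.2 hi)
  have hmem' : ∀ i < t', e i ∈ T' := fun i hi => by
    rw [hT']; exact Finset.mem_image_of_mem _ (Finset.mem_range.2 hi)
  have hpos : 0 < t' := by
    rcases Nat.eq_zero_or_pos t' with h0 | h0
    · simp [hT', h0] at hne
    · exact h0
  have key : ∀ i < t, t' ≤ i →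
      ∃ w ∈ e i, w ∉ T'.biUnion id ∧ ∃ f ∈ T', (e i).erase w ⊆ f := by
    intro i
    induction i using Nat.strong_induction_on with
    | _ i ih =>
      intro hi hti
      obtain ⟨w, hw, hnew, j, hj, hsub⟩ := hstep i (by omega) hi
      have hout : w ∉ T'.biUnion id := by
        intro hmem
        simp only [hT', Finset.mem_biUnion, Finset.mem_image, Finset.mem_range, id] at hmem
        obtain ⟨_, ⟨k, hk, rfl⟩, hwk⟩ := hmem
        exact hnew k (by omega) hwk
      refine ⟨w, hw, hout, ?_⟩
      rcases lt_or_ge j t' with hjt | hjt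
      · exact ⟨e j, hmem' j hjt, hsub⟩
      · obtain ⟨z, hz, hzout, f, hf, hzf⟩ := ih j hj (by omega) hjt
        have hjlt : j < t := by omega
        refine ⟨f, hf, fun a ha => hzf (Finset.mem_erase.2 ⟨?_, hsub ha⟩)⟩
        rintro rfl
        have hl := hleaf a (Finset.mem_biUnion.2 ⟨e j, hmem j hjlt, hz⟩) hzout
        have heq : e i = e j := Finset.card_le_one.1 hl.le _
          (Finset.mem_filter.2 ⟨hmem i hi, Finset.mem_of_mem_erase ha⟩) _
          (Finset.mem_filter.2 ⟨hmem j hjlt, hz⟩)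
        have := hinj (by simpa using hi) (by simpa using hjlt) heq
        omega
  refine ⟨?_, ?_, ?_⟩
  · rw [hT, hT']
    exact Finset.image_subset_image (Finset.range_subset_range.2 htt)
  · intro g hg
    rw [hT] at hg
    obtain ⟨i, hi, rfl⟩ := Finset.mem_image.1 hg
    exact hcard i (Finset.mem_range.1 hi)
  · intro g hg hg'
    rw [hT] at hg
    obtain ⟨i, hi, rfl⟩ := Finset.mem_image.1 hg
    refine key i (Finset.mem_range.1 hi) (not_lt.1 fun hlt => hg' (hmem' i hlt))

/-- The two-element subsets of a triple. -/
theorem eq_pair_of_subset_triple {V : Type*} [DecidableEq V] {a b c : V} {B : Finset V}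
    (hB : B.card = 2) (h : B ⊆ {a, b, c}) : B = {a, b} ∨ B = {a, c} ∨ B = {b, c} := by
  obtain ⟨p, q, hpq, rfl⟩ := Finset.card_eq_two.1 hB
  have hp : p = a ∨ p = b ∨ p = c := by simpa using h (Finset.mem_insert_self p {q})
  have hq : q = a ∨ q = b ∨ q = c := by
    simpa using h (Finset.mem_insert_of_mem (Finset.mem_singleton_self q))
  rcases hp with rfl | rfl | rfl <;> rcases hq with rfl | rfl | rfl <;>
    simp_all [Finset.pair_comm]

/-- the quantities `μ(B)` for the pairs in a trunk of size 2 of a tight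
3-tree with `t` edges. -/
theorem stmt16 {V : Type*} [Fintype V] [DecidableEq V]
    (T : Finset (Finset V)) (t : ℕ) (hTt : T.card = t)
    (hT : IsTightTree 3 T)
    (x y u v : V) (hxy : x ≠ y) (hxu : x ≠ u) (hxv : x ≠ v)
    (hyu : y ≠ u) (hyv : y ≠ v) (huv : u ≠ v)
    (htrunk : IsTrunk 3 T {({x, y, u} : Finset V), ({x, y, v} : Finset V)}) :
    ((nbr T {x, y}) \ ({x, y, u, v} : Finset V)).card = degree T {x, y} - 2 ∧
    ((nbr T {x, u}) \ ({x, y, u, v} : Finset V)).card = degree T {x, u} - 1 ∧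
    ((nbr T {x, v}) \ ({x, y, u, v} : Finset V)).card = degree T {x, v} - 1 ∧
    ((nbr T {y, u}) \ ({x, y, u, v} : Finset V)).card = degree T {y, u} - 1 ∧
    ((nbr T {y, v}) \ ({x, y, u, v} : Finset V)).card = degree T {y, v} - 1 ∧
    ((nbr T {x, y}) \ ({x, y, u, v} : Finset V)).card
      + ((nbr T {x, u}) \ ({x, y, u, v} : Finset V)).card
      + ((nbr T {x, v}) \ ({x, y, u, v} : Finset V)).card
      + ((nbr T {y, u}) \ ({x, y, u, v} : Finset V)).card
      + ((nbr T {y, v}) \ ({x, y, u, v} : Finset V)).card = t - 2 := by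
  obtain ⟨hsub, hcard, hext⟩ := htrunk.exists_erase_subset ⟨_, Finset.mem_insert_self _ _⟩
  set S : Finset V := {x, y, u, v} with hS
  have hU : ({({x, y, u} : Finset V), ({x, y, v} : Finset V)} : Finset (Finset V)).biUnion id
      = S := by
    ext a
    simp only [Finset.mem_biUnion, Finset.mem_insert, Finset.mem_singleton, id, hS]
    grind
  rw [hU] at hext
  have hin : (T.filter fun g => g ⊆ S) = {({x, y, u} : Finset V), ({x, y, v} : Finset V)} := by
    ext g
    constructor
    · intro hg
      obtain ⟨hgT, hgS⟩ := Finset.mem_filter.1 hg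
      by_contra hg'
      obtain ⟨w, hw, hwS, -⟩ := hext g hgT hg'
      exact hwS (hgS hw)
    · intro hg
      refine Finset.mem_filter.2 ⟨hsub hg, ?_⟩
      rw [← hU]
      exact Finset.subset_biUnion_of_mem id hg
  have hne : ({x, y, u} : Finset V) ≠ {x, y, v} := by
    intro h
    have : u ∈ ({x, y, v} : Finset V) := h ▸ by simp
    simp [hxu.symm, hyu.symm, huv] at this
  have hmu : ∀ a b : V, a ≠ b → a ∈ S → b ∈ S →
      (nbr T {a, b} \ S).card = (T.filter fun g => {a, b} ⊆ g ∧ ¬ g ⊆ S).card := by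
    intro a b hab ha hb
    exact card_nbr_sdiff hcard (Finset.card_pair hab)
      (Finset.insert_subset ha (Finset.singleton_subset_iff.2 hb))
  have hxS : x ∈ S := by simp [hS]
  have hyS : y ∈ S := by simp [hS]
  have huS : u ∈ S := by simp [hS]
  have hvS : v ∈ S := by simp [hS]
  rw [hmu x y hxy hxS hyS, hmu x u hxu hxS huS, hmu x v hxv hxS hvS, hmu y u hyu hyS huS,
    hmu y v hyv hyS hvS]
  simp only [degree_eq_card_add_card T _ S, hin]
  have hout : (T.filter fun g => ¬ g ⊆ S).card = t - 2 := by
    have := Finset.card_filter_add_card_filter_not (s := T) (fun g => g ⊆ S)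
    rw [hin, Finset.card_pair hne, hTt] at this
    omega
  have hsum : (T.filter fun g => {x, y} ⊆ g ∧ ¬ g ⊆ S).card
      + (T.filter fun g => {x, u} ⊆ g ∧ ¬ g ⊆ S).card
      + (T.filter fun g => {x, v} ⊆ g ∧ ¬ g ⊆ S).card
      + (T.filter fun g => {y, u} ⊆ g ∧ ¬ g ⊆ S).card
      + (T.filter fun g => {y, v} ⊆ g ∧ ¬ g ⊆ S).card = t - 2 := by
    rw [← hout]
    simp only [Finset.card_filter, ← Finset.sum_add_distrib]
    refine Finset.sum_congr rfl fun g hg => ?_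
    by_cases hgS : g ⊆ S
    · simp [hgS]
    · have hg' : g ∉ ({({x, y, u} : Finset V), ({x, y, v} : Finset V)} :
          Finset (Finset V)) := by
        rw [← hin]
        exact fun h => hgS (Finset.mem_filter.1 h).2
      obtain ⟨w, hw, hwS, f, hf, hgf⟩ := hext g hg hg'
      have hB : (g.erase w).card = 2 := by rw [Finset.card_erase_of_mem hw, hcard g hg]
      have hwx : x ≠ w := fun h => hwS (h ▸ hxS)
      have hwy : y ≠ w := fun h => hwS (h ▸ hyS)
      have hwu : u ≠ w := fun h => hwS (h ▸ huS)
      have hwv : v ≠ w := fun h => hwS (h ▸ hvS)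
      have hpairs : g.erase w = {x, y} ∨ g.erase w = {x, u} ∨ g.erase w = {x, v} ∨
          g.erase w = {y, u} ∨ g.erase w = {y, v} := by
        rcases Finset.mem_insert.1 hf with rfl | hf
        · have := eq_pair_of_subset_triple hB hgf
          tauto
        · rw [Finset.mem_singleton.1 hf] at hgf
          have := eq_pair_of_subset_triple hB hgf
          tauto
      have hg_eq := Finset.insert_erase hw
      simp only [hgS, not_false_eq_true, and_true]
      rcases hpairs with h | h | h | h | h <;> rw [h] at hg_eq <;> rw [← hg_eq] <;>
        simp [Finset.insert_subset_iff, hwx, hwy, hwu, hwv, hxy, hxu, hxv, hyu, hyv, huv,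
          hxy.symm, hxu.symm, hxv.symm, hyu.symm, hyv.symm, huv.symm]
  refine ⟨?_, ?_, ?_, ?_, ?_, hsum⟩ <;>
    simp [Finset.filter_insert, Finset.filter_singleton, Finset.insert_subset_iff, hne,
      hxy, hxu, hxv, hyu, hyv, huv, hxy.symm, hxu.symm, hxv.symm, hyu.symm, hyv.symm, huv.symm]
end
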